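/- arXiv:1201.2741 — 5 statements merged into one kernel-verified Lean document; each statement's English description precedes it below -/
import Mathlib

section
/- Let k be an algebraically closed field of characteristic p > 0, G a finite group, e a primitive central idempotent of the group algebra kG, and B = kGe the corresponding block. Regard B as a kG-module via the conjugation (left-adjoint) action g·b = g b g⁻¹. Suppose M is a kG-submodule of B which is a direct summand of B as a kG-module and which contains an element e + z, where z is a nilpotent element of the center of the ring B. Then for every finitely generated kG-module N lying in B, the multiplication map M ⊗ₖ N → N, m ⊗ n ↦ m·n, is a split surjection of kG-modules, where G acts diagonally on M ⊗ₖ N by g·(m ⊗ n) = (g m g⁻¹) ⊗ (g·n); in particular N is isomorphic to a direct summand of M ⊗ₖ N. -/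
open TensorProduct

/-- A central idempotent `e` is primitive. -/
def IsPrimitiveCentralIdempotent {A : Type} [Ring A] (e : A) : Prop :=
  IsIdempotentElem e ∧ e ∈ Set.center A ∧ e ≠ 0 ∧
    ∀ f₁ f₂ : A, IsIdempotentElem f₁ → IsIdempotentElem f₂ →
      f₁ ∈ Set.center A → f₂ ∈ Set.center A → f₁ * f₂ = 0 → e = f₁ + f₂ →
        f₁ = 0 ∨ f₂ = 0

/-- Conjugation (left-adjoint) action of `g ∈ G` on the group algebra: `b ↦ g b g⁻¹`. -/
noncomputable def conjAct (k G : Type) [Field k] [Group G] (g : G) :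
    MonoidAlgebra k G →ₗ[k] MonoidAlgebra k G :=
  (LinearMap.mulLeft k (MonoidAlgebra.of k G g)).comp
    (LinearMap.mulRight k (MonoidAlgebra.of k G g⁻¹))

/-- The action of an algebra `A` on a module `N`, as a `k`-bilinear map. -/
noncomputable def smulLinear (k : Type) [Field k] (A : Type) [Ring A] [Algebra k A]
    (N : Type) [AddCommGroup N] [Module k N] [Module A N]
    [IsScalarTower k A N] [SMulCommClass k A N] :
    A →ₗ[k] N →ₗ[k] N where
  toFun a :=
    { toFun := fun n => a • n
      map_add' := fun m n => smul_add a m n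
      map_smul' := fun c n => (smul_comm c a n).symm }
  map_add' a b := LinearMap.ext fun n => add_smul a b n
  map_smul' c a := LinearMap.ext fun n => smul_assoc c a n

/-- Let `B = kGe` be a block of `kG`, regarded as a `kG`-module via conjugation, and let
`M` be a `G`-stable submodule of `B` which is a direct summand of `B` (as a `kG`-module
via conjugation) and contains `e + z` with `z` a nilpotent element of the center of the
ring `B`.  Then for every finitely generated `kG`-module `N` lying in `B`, the
multiplication map `f : M ⊗ₖ N → N` is a split surjection of `kG`-modules (where `G` acts
diagonally on `M ⊗ₖ N`); in particular `N` is a direct summand of `M ⊗ₖ N`. -/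
theorem stmt1 (k : Type) [Field k] [IsAlgClosed k] (p : ℕ) [Fact p.Prime] [CharP k p]
    (G : Type) [Group G] [Fintype G]
    (e : MonoidAlgebra k G) (he : IsPrimitiveCentralIdempotent e)
    (B : Submodule k (MonoidAlgebra k G))
    (hB : B = LinearMap.range (LinearMap.mulRight k e))
    (M : Submodule k (MonoidAlgebra k G)) (hMB : M ≤ B)
    (hMinv : ∀ g : G, ∀ x ∈ M, conjAct k G g x ∈ M)
    (hsummand : ∃ M' : Submodule k (MonoidAlgebra k G), M' ≤ B ∧
      (∀ g : G, ∀ x ∈ M', conjAct k G g x ∈ M') ∧ M ⊓ M' = ⊥ ∧ M ⊔ M' = B)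
    (z : MonoidAlgebra k G) (hzB : z ∈ B) (hzcentral : ∀ c ∈ B, z * c = c * z)
    (hznilp : IsNilpotent z) (hez : e + z ∈ M)
    (N : Type) [AddCommGroup N] [Module k N] [Module (MonoidAlgebra k G) N]
    [IsScalarTower k (MonoidAlgebra k G) N] [SMulCommClass k (MonoidAlgebra k G) N]
    (hfg : Module.Finite (MonoidAlgebra k G) N) (hlies : ∀ n : N, e • n = n) :
    ∀ f : (↥M ⊗[k] N) →ₗ[k] N,
      f = TensorProduct.lift
            ((smulLinear k (MonoidAlgebra k G) N).comp M.subtype) →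
      (∀ g : G,
        f.comp (TensorProduct.map ((conjAct k G g).restrict (hMinv g))
            (smulLinear k (MonoidAlgebra k G) N (MonoidAlgebra.of k G g))) =
          (smulLinear k (MonoidAlgebra k G) N (MonoidAlgebra.of k G g)).comp f) ∧
      ∃ h : N →ₗ[k] (↥M ⊗[k] N),
        (∀ g : G,
          h.comp (smulLinear k (MonoidAlgebra k G) N (MonoidAlgebra.of k G g)) =
            (TensorProduct.map ((conjAct k G g).restrict (hMinv g))
              (smulLinear k (MonoidAlgebra k G) N (MonoidAlgebra.of k G g))).comp h) ∧
        f.comp h = LinearMap.id := by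
  have hecenter := he.2.1
  have hze : z * e = z := by
    obtain ⟨y, rfl⟩ := hB ▸ hzB
    simp [mul_assoc, he.1.eq]
  have hec : ∀ c, c * e = e * c := fun c => ((Set.mem_center_iff.mp hecenter).comm c).symm
  have hzc : ∀ c, Commute z c := fun c => by
    have hc := hzcentral (c * e) (hB ▸ ⟨c, rfl⟩)
    calc z * c = z * e * c := by rw [hze]
      _ = c * e * z := by rw [mul_assoc, ← hec, hc]
      _ = c * z := by rw [mul_assoc, ← hec, hze]
  obtain ⟨u, hu⟩ := hznilp.isUnit_one_add
  have huc : ∀ c, Commute (↑u⁻¹ : MonoidAlgebra k G) c := fun c =>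
    Commute.units_inv_left (hu ▸ (Commute.one_left c).add_left (hzc c))
  have hfix : ∀ g : G, conjAct k G g (e + z) = e + z := fun g => by
    have h : (e + z) * MonoidAlgebra.of k G g⁻¹ = MonoidAlgebra.of k G g⁻¹ * (e + z) := by
      rw [add_mul, mul_add, ← hec, (hzc _).eq]
    simp only [conjAct, LinearMap.comp_apply, LinearMap.mulLeft_apply, LinearMap.mulRight_apply]
    rw [h, ← mul_assoc, ← map_mul, mul_inv_cancel, map_one, one_mul]
  rintro f rfl
  refine ⟨fun g => TensorProduct.ext' fun m n => ?_,
    (TensorProduct.mk k M N ⟨e + z, hez⟩).comp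
      (smulLinear k (MonoidAlgebra k G) N (↑u⁻¹ : MonoidAlgebra k G)), fun g => ?_, ?_⟩
  · change ((MonoidAlgebra.of k G g * (↑m * MonoidAlgebra.of k G g⁻¹)) •
      (MonoidAlgebra.of k G g • n) : N) = MonoidAlgebra.of k G g • ((m : MonoidAlgebra k G) • n)
    rw [smul_smul, smul_smul, mul_assoc, mul_assoc, ← map_mul, inv_mul_cancel, map_one, mul_one]
  · ext n
    have hsub : (conjAct k G g).restrict (hMinv g) ⟨e + z, hez⟩ = ⟨e + z, hez⟩ :=
      Subtype.ext (hfix g)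
    change (⟨e + z, hez⟩ : M) ⊗ₜ[k] ((↑u⁻¹ : MonoidAlgebra k G) • (MonoidAlgebra.of k G g • n)) =
      (conjAct k G g).restrict (hMinv g) ⟨e + z, hez⟩ ⊗ₜ[k]
        (MonoidAlgebra.of k G g • ((↑u⁻¹ : MonoidAlgebra k G) • n))
    rw [hsub, smul_smul, smul_smul, (huc _).eq]
  · ext n
    change (e + z) • ((↑u⁻¹ : MonoidAlgebra k G) • n) = n
    have h : (e + z) • ((↑u⁻¹ : MonoidAlgebra k G) • n) =
        (1 + z) • ((↑u⁻¹ : MonoidAlgebra k G) • n) := by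
      rw [add_smul, add_smul, hlies, one_smul]
    rw [h, ← hu, smul_smul, Units.mul_inv, one_smul]
end

section
/- Let k be an algebraically closed field of characteristic p > 0, G a finite group, e a primitive central idempotent of the group algebra kG, and B = kGe the corresponding block, regarded as a kG-module via the conjugation action g·b = g b g⁻¹. Then there exists an indecomposable kG-module direct summand M of B (under the conjugation action) such that every finitely generated kG-module N lying in B is isomorphic to a direct summand of M ⊗ₖ N, where G acts diagonally on the tensor product. -/
open TensorProduct

/-- In a commutative Artinian ring, a primitive idempotent `e` generates a local
factor: of two elements summing to `e`, one is invertible modulo `e`. -/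
theorem exists_mul_eq_or_exists_mul_eq {Z : Type} [CommRing Z] [IsArtinianRing Z] {e : Z}
    (he : IsIdempotentElem e)
    (hprim : ∀ f₁ f₂ : Z, IsIdempotentElem f₁ → IsIdempotentElem f₂ → f₁ * f₂ = 0 →
      e = f₁ + f₂ → f₁ = 0 ∨ f₂ = 0)
    {x y : Z} (hxy : x + y = e) : (∃ v, x * v = e) ∨ ∃ v, y * v = e := by
  obtain ⟨n, c, hc⟩ := IsArtinian.exists_pow_succ_smul_dvd x (1 : Z)
  simp only [smul_eq_mul, mul_one, Nat.succ_eq_add_one] at hc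
  have hpow : ∀ m : ℕ, x ^ (n + m) * c ^ m = x ^ n := by
    intro m
    induction m with
    | zero => simp
    | succ m ih =>
      calc x ^ (n + (m + 1)) * c ^ (m + 1) = (x ^ (n + 1) * c) * x ^ m * c ^ m := by ring
        _ = x ^ (n + m) * c ^ m := by rw [hc]; ring
        _ = x ^ n := ih
  have hee : e * e = e := he
  have hpow' : x ^ (n + 1) * (x ^ (n + 1) * c ^ (n + 1)) = x ^ (n + 1) := by
    calc x ^ (n + 1) * (x ^ (n + 1) * c ^ (n + 1))
        = x * (x ^ (n + (n + 1)) * c ^ (n + 1)) := by ring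
      _ = x ^ (n + 1) := by rw [hpow]; ring
  set f := x ^ (n + 1) * c ^ (n + 1) * e with hf
  have hff : f * f = f := by
    calc f * f = x ^ (n + 1) * (x ^ (n + 1) * c ^ (n + 1)) * c ^ (n + 1) * (e * e) := by
          rw [hf]; ring
      _ = f := by rw [hpow', hee]
  have hfe : f * e = f := by rw [hf, mul_assoc, hee]
  have hcompl : IsIdempotentElem (e - f) := by
    change (e - f) * (e - f) = e - f
    linear_combination hee - 2 * hfe + hff
  rcases hprim f (e - f) hff hcompl (by linear_combination hfe - hff) (by ring) with h | h
  · right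
    have hnil : IsNilpotent (x * e) := by
      refine ⟨n + 1, ?_⟩
      calc (x * e) ^ (n + 1) = x ^ (n + 1) * (x ^ (n + 1) * c ^ (n + 1)) * e ^ (n + 1) := by
            rw [hpow', mul_pow]
        _ = x ^ (n + 1) * f * e ^ n := by rw [hf]; ring
        _ = 0 := by rw [h]; ring
    obtain ⟨w, hw⟩ := hnil.isUnit_one_sub.exists_right_inv
    exact ⟨e * w, by linear_combination e * hw + e * w * hxy + (w + w * x) * hee⟩
  · left
    exact ⟨x ^ n * c ^ (n + 1) * e, by linear_combination -h + hf⟩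

section conjAct

variable {k G : Type} [Field k] [Group G]

theorem conjAct_apply (g : G) (x : MonoidAlgebra k G) :
    conjAct k G g x = MonoidAlgebra.of k G g * (x * MonoidAlgebra.of k G g⁻¹) := rfl

theorem of_mul_of_inv (g : G) :
    MonoidAlgebra.of k G g * MonoidAlgebra.of k G g⁻¹ = 1 := by
  rw [← map_mul, mul_inv_cancel, map_one]

theorem of_inv_mul_of (g : G) :
    MonoidAlgebra.of k G g⁻¹ * MonoidAlgebra.of k G g = 1 := by
  rw [← map_mul, inv_mul_cancel, map_one]

/-- The fixed points of the conjugation action are the central elements. -/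
theorem mem_center_iff_conjAct_eq (a : MonoidAlgebra k G) :
    a ∈ Subalgebra.center k (MonoidAlgebra k G) ↔ ∀ g : G, conjAct k G g a = a := by
  rw [Subalgebra.mem_center_iff]
  constructor
  · intro h g
    rw [conjAct_apply, ← mul_assoc, h, mul_assoc, of_mul_of_inv, mul_one]
  · intro h b
    induction b using MonoidAlgebra.induction_on with
    | of g =>
      conv_rhs => rw [← h g]
      rw [conjAct_apply, mul_assoc, mul_assoc, of_inv_mul_of, mul_one]
    | add x y hx hy => rw [add_mul, mul_add, hx, hy]
    | smul r x hx => rw [smul_mul_assoc, mul_smul_comm, hx]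

/-- The components of a fixed point in a stable direct sum decomposition are fixed. -/
theorem mem_center_of_add_mem_center {M₁ M₂ : Submodule k (MonoidAlgebra k G)}
    (h₁ : ∀ g : G, ∀ x ∈ M₁, conjAct k G g x ∈ M₁)
    (h₂ : ∀ g : G, ∀ x ∈ M₂, conjAct k G g x ∈ M₂) (hdisj : Disjoint M₁ M₂)
    {a b : MonoidAlgebra k G} (ha : a ∈ M₁) (hb : b ∈ M₂)
    (hab : a + b ∈ Subalgebra.center k (MonoidAlgebra k G)) :
    a ∈ Subalgebra.center k (MonoidAlgebra k G) := by
  rw [mem_center_iff_conjAct_eq] at hab ⊢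
  intro g
  have hg := hab g
  rw [map_add] at hg
  rw [← sub_eq_zero]
  refine Submodule.disjoint_def.mp hdisj _ (sub_mem (h₁ g a ha) ha) ?_
  have : conjAct k G g a - a = b - conjAct k G g b := by
    rw [sub_eq_sub_iff_add_eq_add, hg, add_comm]
  rw [this]
  exact sub_mem hb (h₂ g b hb)

end conjAct

/-- A stable direct summand of `B` containing a central element that is invertible modulo `e`. -/
def IsUnitalSummand {k G : Type} [Field k] [Group G] (e : MonoidAlgebra k G)
    (B M : Submodule k (MonoidAlgebra k G)) : Prop :=
  (∀ g : G, ∀ x ∈ M, conjAct k G g x ∈ M) ∧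
    (∃ M' : Submodule k (MonoidAlgebra k G),
      (∀ g : G, ∀ x ∈ M', conjAct k G g x ∈ M') ∧ Disjoint M M' ∧ M ⊔ M' = B) ∧
    ∃ a u : Subalgebra.center k (MonoidAlgebra k G),
      (a : MonoidAlgebra k G) ∈ M ∧ (a * u : MonoidAlgebra k G) = e

section IsUnitalSummand

variable {k G : Type} [Field k] [Group G]

theorem conjAct_mem_sup {M₁ M₂ : Submodule k (MonoidAlgebra k G)}
    (h₁ : ∀ g : G, ∀ x ∈ M₁, conjAct k G g x ∈ M₁)
    (h₂ : ∀ g : G, ∀ x ∈ M₂, conjAct k G g x ∈ M₂) (g : G) :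
    ∀ x ∈ M₁ ⊔ M₂, conjAct k G g x ∈ M₁ ⊔ M₂ := by
  intro x hx
  obtain ⟨y, hy, z, hz, rfl⟩ := Submodule.mem_sup.mp hx
  rw [map_add]
  exact Submodule.add_mem_sup (h₁ g y hy) (h₂ g z hz)

/-- A stable direct summand of a unital summand is unital once it contains a central element
that is invertible modulo `e`. -/
theorem IsUnitalSummand.of_sup {e : MonoidAlgebra k G} {B M₁ M₂ : Submodule k (MonoidAlgebra k G)}
    (hM : IsUnitalSummand e B (M₁ ⊔ M₂))
    (h₁ : ∀ g : G, ∀ x ∈ M₁, conjAct k G g x ∈ M₁)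
    (h₂ : ∀ g : G, ∀ x ∈ M₂, conjAct k G g x ∈ M₂) (hdisj : Disjoint M₁ M₂)
    {a u : Subalgebra.center k (MonoidAlgebra k G)} (ha : (a : MonoidAlgebra k G) ∈ M₁)
    (hau : (a * u : MonoidAlgebra k G) = e) : IsUnitalSummand e B M₁ := by
  obtain ⟨-, ⟨M', hM', hd, hs⟩, -⟩ := hM
  exact ⟨h₁, ⟨M₂ ⊔ M', conjAct_mem_sup h₂ hM', hdisj.disjoint_sup_right_of_disjoint_sup_left hd,
    by rw [← sup_assoc, hs]⟩, a, u, ha, hau⟩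

theorem IsUnitalSummand.left_or_right [Finite G] {e : MonoidAlgebra k G}
    (he : IsPrimitiveCentralIdempotent e) {B M₁ M₂ : Submodule k (MonoidAlgebra k G)}
    (hM : IsUnitalSummand e B (M₁ ⊔ M₂))
    (h₁ : ∀ g : G, ∀ x ∈ M₁, conjAct k G g x ∈ M₁)
    (h₂ : ∀ g : G, ∀ x ∈ M₂, conjAct k G g x ∈ M₂) (hdisj : Disjoint M₁ M₂) :
    IsUnitalSummand e B M₁ ∨ IsUnitalSummand e B M₂ := by
  obtain ⟨-, -, a, u, ha, hau⟩ := id hM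
  obtain ⟨hidem, hcent, -, hprim⟩ := he
  obtain ⟨a₁, ha₁, a₂, ha₂, hsum⟩ := Submodule.mem_sup.mp ha
  have hc₁ := mem_center_of_add_mem_center h₁ h₂ hdisj ha₁ ha₂ (hsum ▸ a.2)
  have hc₂ := mem_center_of_add_mem_center h₂ h₁ hdisj.symm ha₂ ha₁
    (by rw [add_comm, hsum]; exact a.2)
  have : Module.Finite k (MonoidAlgebra k G) := Module.Finite.of_basis (MonoidAlgebra.basis G k)
  have : IsArtinianRing (Subalgebra.center k (MonoidAlgebra k G)) :=
    IsArtinianRing.of_finite k _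
  let b₁ : Subalgebra.center k (MonoidAlgebra k G) := ⟨a₁, hc₁⟩
  let b₂ : Subalgebra.center k (MonoidAlgebra k G) := ⟨a₂, hc₂⟩
  have key := exists_mul_eq_or_exists_mul_eq (Z := Subalgebra.center k (MonoidAlgebra k G))
    (e := ⟨e, hcent⟩) (x := b₁ * u) (y := b₂ * u) (Subtype.ext hidem)
    (fun f₁ f₂ hf₁ hf₂ hf hef => by
      simpa using hprim f₁ f₂ (congrArg Subtype.val hf₁) (congrArg Subtype.val hf₂) f₁.2 f₂.2
        (congrArg Subtype.val hf) (congrArg Subtype.val hef))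
    (Subtype.ext (by
      change a₁ * (u : MonoidAlgebra k G) + a₂ * u = e
      rw [← add_mul, hsum, hau]))
  rcases key with ⟨v, hv⟩ | ⟨v, hv⟩
  · exact Or.inl (hM.of_sup h₁ h₂ hdisj (a := b₁) (u := u * v) ha₁
      (by simpa [mul_assoc] using congrArg Subtype.val hv))
  · rw [sup_comm] at hM
    exact Or.inr (hM.of_sup h₂ h₁ hdisj.symm (a := b₂) (u := u * v) ha₂
      (by simpa [mul_assoc] using congrArg Subtype.val hv))

/-- The block itself is a unital summand. -/
theorem isUnitalSummand_range_mulRight {e : MonoidAlgebra k G}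
    (hcent : e ∈ Set.center (MonoidAlgebra k G)) :
    IsUnitalSummand e (LinearMap.range (LinearMap.mulRight k e))
      (LinearMap.range (LinearMap.mulRight k e)) := by
  refine ⟨?_, ⟨⊥, ?_, disjoint_bot_right, sup_bot_eq _⟩, ⟨e, hcent⟩, 1, ⟨1, by simp⟩, by simp⟩
  · rintro g _ ⟨x, rfl⟩
    refine ⟨conjAct k G g x, ?_⟩
    simp only [LinearMap.mulRight_apply, conjAct_apply, mul_assoc]
    rw [(Subalgebra.mem_center_iff (R := k)).mp hcent]
  · intro g x hx
    rw [Submodule.mem_bot] at hx ⊢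
    rw [hx, map_zero]

/-- A module lying in the block is a direct summand of its tensor product with any unital
summand. -/
theorem IsUnitalSummand.exists_splitting {e : MonoidAlgebra k G}
    {B M : Submodule k (MonoidAlgebra k G)} (hM : IsUnitalSummand e B M)
    (hMinv : ∀ g : G, ∀ x ∈ M, conjAct k G g x ∈ M)
    (N : Type) [AddCommGroup N] [Module k N] [Module (MonoidAlgebra k G) N]
    [IsScalarTower k (MonoidAlgebra k G) N] [SMulCommClass k (MonoidAlgebra k G) N]
    (hN : ∀ n : N, e • n = n) :
    ∃ (π : (↥M ⊗[k] N) →ₗ[k] N) (ι : N →ₗ[k] (↥M ⊗[k] N)),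
      (∀ g : G,
        π.comp (TensorProduct.map ((conjAct k G g).restrict (hMinv g))
            (smulLinear k (MonoidAlgebra k G) N (MonoidAlgebra.of k G g))) =
          (smulLinear k (MonoidAlgebra k G) N (MonoidAlgebra.of k G g)).comp π) ∧
      (∀ g : G,
        ι.comp (smulLinear k (MonoidAlgebra k G) N (MonoidAlgebra.of k G g)) =
          (TensorProduct.map ((conjAct k G g).restrict (hMinv g))
            (smulLinear k (MonoidAlgebra k G) N (MonoidAlgebra.of k G g))).comp ι) ∧
      π.comp ι = LinearMap.id := by
  obtain ⟨-, -, a, u, ha, hau⟩ := hM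
  refine ⟨TensorProduct.lift ((smulLinear k (MonoidAlgebra k G) N).comp M.subtype),
    (TensorProduct.mk k M N ⟨a, ha⟩).comp (smulLinear k (MonoidAlgebra k G) N u),
    fun g => ?_, fun g => ?_, ?_⟩
  · ext m n
    change (conjAct k G g m) • MonoidAlgebra.of k G g • n =
      MonoidAlgebra.of k G g • (m : MonoidAlgebra k G) • n
    rw [smul_smul, smul_smul, conjAct_apply, mul_assoc, mul_assoc, of_inv_mul_of, mul_one]
  · ext n
    have hfix : (conjAct k G g).restrict (hMinv g) ⟨a, ha⟩ = ⟨a, ha⟩ :=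
      Subtype.ext ((mem_center_iff_conjAct_eq _).mp a.2 g)
    change (⟨a, ha⟩ : M) ⊗ₜ[k] ((u : MonoidAlgebra k G) • MonoidAlgebra.of k G g • n) =
      ((conjAct k G g).restrict (hMinv g) ⟨a, ha⟩) ⊗ₜ[k]
        (MonoidAlgebra.of k G g • (u : MonoidAlgebra k G) • n)
    rw [hfix, smul_smul, smul_smul, Subalgebra.mem_center_iff.mp u.2]
  · ext n
    change (a : MonoidAlgebra k G) • (u : MonoidAlgebra k G) • n = n
    rw [smul_smul, hau, hN]

end IsUnitalSummand

/-- Let `B = kGe` be a block of `kG`, regarded as a `kG`-module via the conjugation action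
`g · b = g b g⁻¹`.  Then there is an indecomposable `G`-stable direct summand `M` of `B`
such that every finitely generated `kG`-module `N` lying in `B` is (G-equivariantly) a
direct summand of `M ⊗ₖ N`, with the diagonal `G`-action on the tensor product. -/
theorem stmt2 (k : Type) [Field k] [IsAlgClosed k] (p : ℕ) [Fact p.Prime] [CharP k p]
    (G : Type) [Group G] [Fintype G]
    (e : MonoidAlgebra k G) (he : IsPrimitiveCentralIdempotent e)
    (B : Submodule k (MonoidAlgebra k G))
    (hB : B = LinearMap.range (LinearMap.mulRight k e)) :
    ∃ (M : Submodule k (MonoidAlgebra k G)) (hMinv : ∀ g : G, ∀ x ∈ M, conjAct k G g x ∈ M),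
      M ≤ B ∧
      -- `M` is a direct summand of `B` as a `kG`-module under conjugation
      (∃ M' : Submodule k (MonoidAlgebra k G), M' ≤ B ∧
        (∀ g : G, ∀ x ∈ M', conjAct k G g x ∈ M') ∧ M ⊓ M' = ⊥ ∧ M ⊔ M' = B) ∧
      -- `M` is indecomposable as a `kG`-module under conjugation
      M ≠ ⊥ ∧
      (¬ ∃ M₁ M₂ : Submodule k (MonoidAlgebra k G),
        (∀ g : G, ∀ x ∈ M₁, conjAct k G g x ∈ M₁) ∧
        (∀ g : G, ∀ x ∈ M₂, conjAct k G g x ∈ M₂) ∧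
        M₁ ≠ ⊥ ∧ M₂ ≠ ⊥ ∧ M₁ ⊓ M₂ = ⊥ ∧ M₁ ⊔ M₂ = M) ∧
      -- every finitely generated module lying in `B` is a direct summand of `M ⊗ₖ N`
      ∀ (N : Type) [AddCommGroup N] [Module k N] [Module (MonoidAlgebra k G) N]
        [IsScalarTower k (MonoidAlgebra k G) N] [SMulCommClass k (MonoidAlgebra k G) N],
        Module.Finite (MonoidAlgebra k G) N → (∀ n : N, e • n = n) →
        ∃ (π : (↥M ⊗[k] N) →ₗ[k] N) (ι : N →ₗ[k] (↥M ⊗[k] N)),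
          (∀ g : G,
            π.comp (TensorProduct.map ((conjAct k G g).restrict (hMinv g))
                (smulLinear k (MonoidAlgebra k G) N (MonoidAlgebra.of k G g))) =
              (smulLinear k (MonoidAlgebra k G) N (MonoidAlgebra.of k G g)).comp π) ∧
          (∀ g : G,
            ι.comp (smulLinear k (MonoidAlgebra k G) N (MonoidAlgebra.of k G g)) =
              (TensorProduct.map ((conjAct k G g).restrict (hMinv g))
                (smulLinear k (MonoidAlgebra k G) N (MonoidAlgebra.of k G g))).comp ι) ∧
          π.comp ι = LinearMap.id := by
  obtain ⟨-, hcent, hne, -⟩ := id he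
  have : Module.Finite k (MonoidAlgebra k G) := Module.Finite.of_basis (MonoidAlgebra.basis G k)
  obtain ⟨M, hM, hmin⟩ := WellFounded.has_min
    (wellFounded_lt : WellFounded ((· < ·) : Submodule k (MonoidAlgebra k G) → _ → Prop))
    {M | IsUnitalSummand e B M} ⟨B, hB ▸ isUnitalSummand_range_mulRight hcent⟩
  obtain ⟨hMinv, ⟨M', hM', hd, hs⟩, a, u, ha, hau⟩ := id hM
  refine ⟨M, hMinv, hs ▸ le_sup_left, ⟨M', hs ▸ le_sup_right, hM', hd.eq_bot, hs⟩, ?_, ?_,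
    fun N _ _ _ _ _ _ hN => hM.exists_splitting hMinv N hN⟩
  · rintro rfl
    rw [Submodule.mem_bot] at ha
    exact hne (by rw [← hau, ha, zero_mul])
  · rintro ⟨M₁, M₂, h₁, h₂, hne₁, hne₂, hinf, rfl⟩
    have hdisj : Disjoint M₁ M₂ := disjoint_iff.mpr hinf
    rcases IsUnitalSummand.left_or_right he hM h₁ h₂ hdisj with h | h
    · exact hmin M₁ h (left_lt_sup.mpr fun hle => hne₂ (hdisj.eq_bot_of_ge hle))
    · exact hmin M₂ h (right_lt_sup.mpr fun hle => hne₁ (hdisj.eq_bot_of_le hle))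
end

section
/- Let k be an algebraically closed field and H a finite-dimensional Hopf algebra over k with comultiplication Δ, counit ε and antipode S. Let e₀ be a central idempotent of H with ε(e₀) = 1, and suppose that the quotient ring H/H(1−e₀) (equivalently, the ring He₀ with identity e₀) is a local ring. Then the two-sided ideal I = H(1−e₀) is a Hopf ideal of H: ε(I) = 0, Δ(I) ⊆ I ⊗ H + H ⊗ I, and S(I) ⊆ I. -/
open TensorProduct
section LocalCorner

variable {k H : Type*} [Field k] [Ring H] [HopfAlgebra k H] {e : H}

/-- If `e - b` is left invertible in a corner `He` containing the idempotent `b`, then `b = 0`. -/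
theorem IsIdempotentElem.eq_zero_of_mul_sub_eq {R : Type*} [Ring R] {e b c : R}
    (hb : IsIdempotentElem b) (heb : e * b = b) (hc : c * (e - b) = e) : b = 0 := by
  rw [← heb, ← hc, mul_assoc, sub_mul, heb, hb.eq, sub_self, mul_zero]

/-- The augmentation ideal of the corner `He`, as a subspace of `H`. -/
def cornerAugmentation (k : Type*) {H : Type*} [Field k] [Ring H] [HopfAlgebra k H] (e : H) :
    Submodule k H :=
  LinearMap.range (LinearMap.mulRight k e) ⊓ LinearMap.ker (Coalgebra.counit (R := k) (A := H))

theorem mem_cornerAugmentation (he : IsIdempotentElem e) {x : H} :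
    x ∈ cornerAugmentation k e ↔ x * e = x ∧ Coalgebra.counit (R := k) x = 0 := by
  simp only [cornerAugmentation, Submodule.mem_inf, LinearMap.mem_range, LinearMap.mulRight_apply,
    LinearMap.mem_ker]
  refine and_congr_left fun _ => ⟨?_, fun h => ⟨x, h⟩⟩
  rintro ⟨y, rfl⟩
  rw [mul_assoc, he.eq]

/-- If every `e - b` with `b` in the augmentation ideal of `He` is left invertible in `He`, then
this augmentation ideal lies in the Jacobson radical of `H`. -/
theorem cornerAugmentation_le_jacobson (he : IsIdempotentElem e) (hcomm : ∀ x, e * x = x * e)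
    (hinv : ∀ b ∈ cornerAugmentation k e, ∃ c, c * e = c ∧ c * (e - b) = e)
    {x : H} (hx : x ∈ cornerAugmentation k e) : x ∈ Ring.jacobson H := by
  rw [← Ideal.jacobson_bot, Ideal.mem_jacobson_iff]
  intro y
  rw [mem_cornerAugmentation he] at hx
  obtain ⟨hxe, hx0⟩ := hx
  have hyx : y * x * e = y * x := by rw [mul_assoc, hxe]
  obtain ⟨c, hce, hc⟩ := hinv (-(y * x)) <| (mem_cornerAugmentation he).2
    ⟨by rw [neg_mul, hyx], by rw [map_neg, Bialgebra.counit_mul, hx0, mul_zero, neg_zero]⟩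
  refine ⟨c + 1 - e, ?_⟩
  have h : (c + 1 - e) * y * x + (c + 1 - e) - 1 =
      (c * (e - -(y * x)) - e) + (c - c * e) + (y * x - e * (y * x)) := by noncomm_ring
  rw [h, hc, hce, hcomm, hyx]
  simp

theorem isNilpotent_cornerAugmentation [FiniteDimensional k H] (he : IsIdempotentElem e)
    (hcomm : ∀ x, e * x = x * e)
    (hinv : ∀ b ∈ cornerAugmentation k e, ∃ c, c * e = c ∧ c * (e - b) = e) :
    IsNilpotent (cornerAugmentation k e) := by
  have : IsArtinianRing H := IsArtinianRing.of_finite k H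
  obtain ⟨n, hn⟩ := IsSemiprimaryRing.isNilpotent (R := H)
  have hpow : ∀ m : ℕ, ∀ x ∈ cornerAugmentation k e ^ m, x ∈ Ring.jacobson H ^ m := by
    intro m
    induction m with
    | zero =>
      intro x _
      rw [Submodule.pow_zero, Ideal.one_eq_top]
      trivial
    | succ m ih =>
      intro x hx
      rw [Submodule.pow_succ] at hx ⊢
      refine Submodule.mul_induction_on hx (fun a ha b hb => ?_) fun a b => add_mem
      exact Ideal.mul_mem_mul (ih a ha) (cornerAugmentation_le_jacobson he hcomm hinv hb)
  refine ⟨n, (Submodule.eq_bot_iff _).2 fun x hx => ?_⟩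
  have := hpow n x hx
  rw [hn] at this
  exact this

/-- The subspace `P ⊗ B` of `A ⊗ B` spanned by the tensors `p ⊗ b` with `p ∈ P`. -/
def Submodule.leftTensorSpan {R A : Type*} (B : Type*) [CommRing R] [Ring A] [Algebra R A]
    [Ring B] [Algebra R B] (P : Submodule R A) : Submodule R (A ⊗[R] B) :=
  Submodule.span R {z | ∃ p ∈ P, ∃ b : B, z = p ⊗ₜ[R] b}

section LeftTensorSpan

variable {R A B : Type*} [CommRing R] [Ring A] [Algebra R A] [Ring B] [Algebra R B]

theorem Submodule.leftTensorSpan_mul_le (P Q : Submodule R A) :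
    P.leftTensorSpan B * Q.leftTensorSpan B ≤ (P * Q).leftTensorSpan B := by
  rw [leftTensorSpan, leftTensorSpan, Submodule.span_mul_span, Submodule.span_le]
  rintro _ ⟨_, ⟨p, hp, b, rfl⟩, _, ⟨q, hq, c, rfl⟩, rfl⟩
  exact Submodule.subset_span
    ⟨p * q, Submodule.mul_mem_mul hp hq, b * c, Algebra.TensorProduct.tmul_mul_tmul ..⟩

theorem Submodule.leftTensorSpan_bot : (⊥ : Submodule R A).leftTensorSpan B = ⊥ := by
  rw [leftTensorSpan, Submodule.span_eq_bot]
  rintro _ ⟨p, hp, b, rfl⟩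
  rw [(Submodule.mem_bot R).1 hp, TensorProduct.zero_tmul]

theorem IsIdempotentElem.eq_zero_of_mem_leftTensorSpan {P : Submodule R A} (hP : IsNilpotent P)
    {g : A ⊗[R] B} (hg : IsIdempotentElem g) (hgP : g ∈ P.leftTensorSpan B) : g = 0 := by
  obtain ⟨n, hn⟩ := hP
  have h : ∀ m : ℕ, g ∈ (P ^ (m + 1)).leftTensorSpan B := by
    intro m
    induction m with
    | zero => simpa using hgP
    | succ m ih =>
      rw [pow_succ, ← hg.eq]
      exact Submodule.leftTensorSpan_mul_le _ _ (Submodule.mul_mem_mul ih hgP)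
  have := h n
  rwa [pow_succ, hn, zero_mul, Submodule.zero_eq_bot, Submodule.leftTensorSpan_bot,
    Submodule.mem_bot] at this

end LeftTensorSpan

/-- The algebra map `ε ⊗ id : H ⊗ H → H`. -/
noncomputable def counitTensorId (k H : Type*) [Field k] [Ring H] [HopfAlgebra k H] :
    H ⊗[k] H →ₐ[k] H :=
  (Algebra.TensorProduct.lid k H).toAlgHom.comp
    (Algebra.TensorProduct.map (Bialgebra.counitAlgHom k H) (AlgHom.id k H))

@[simp]
theorem counitTensorId_tmul (a b : H) :
    counitTensorId k H (a ⊗ₜ[k] b) = Coalgebra.counit (R := k) a • b := by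
  simp [counitTensorId]

theorem counitTensorId_comul (x : H) :
    counitTensorId k H (Coalgebra.comul (R := k) x) = x := by
  have h : (counitTensorId k H).toLinearMap = (TensorProduct.lid k H).toLinearMap ∘ₗ
      LinearMap.rTensor H (Coalgebra.counit (R := k) (A := H)) := by
    ext a b
    simp
  calc counitTensorId k H (Coalgebra.comul (R := k) x)
      = (counitTensorId k H).toLinearMap (Coalgebra.comul (R := k) x) := rfl
    _ = x := by rw [h]; simp

theorem tmul_one_mul_sub_mem (he : IsIdempotentElem e) (hcomm : ∀ x, e * x = x * e)
    (hcounit : Coalgebra.counit (R := k) e = 1) (x : H ⊗[k] H) :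
    e ⊗ₜ[k] (1 : H) * x - e ⊗ₜ[k] counitTensorId k H x ∈
      (cornerAugmentation k e).leftTensorSpan H := by
  induction x with
  | zero => simp
  | add x y hx hy =>
    rw [mul_add, map_add, TensorProduct.tmul_add, add_sub_add_comm]
    exact add_mem hx hy
  | tmul a b =>
    refine Submodule.subset_span ⟨e * a - Coalgebra.counit (R := k) a • e, ?_, b, ?_⟩
    · rw [mem_cornerAugmentation he]
      constructor
      · rw [sub_mul, smul_mul_assoc, he.eq, hcomm a, mul_assoc, he.eq]
      · simp [Bialgebra.counit_mul, hcounit]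
    · simp [TensorProduct.sub_tmul, TensorProduct.smul_tmul]

/-- For a central idempotent `e` with `ε(e) = 1` such that `He` is local, `e ⊗ e` is fixed by
`Δ(e)`. -/
theorem tmul_mul_comul_eq [FiniteDimensional k H] (he : IsIdempotentElem e)
    (hcomm : ∀ x, e * x = x * e) (hcounit : Coalgebra.counit (R := k) e = 1)
    (hinv : ∀ b ∈ cornerAugmentation k e, ∃ c, c * e = c ∧ c * (e - b) = e) :
    e ⊗ₜ[k] e * Coalgebra.comul (R := k) (1 - e) = 0 := by
  have hE : IsIdempotentElem (e ⊗ₜ[k] e) := by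
    rw [IsIdempotentElem, Algebra.TensorProduct.tmul_mul_tmul, he.eq]
  have hEcomm : ∀ x : H ⊗[k] H, Commute (e ⊗ₜ[k] e) x := by
    intro x
    induction x with
    | zero => exact Commute.zero_right _
    | add x y hx hy => exact hx.add_right hy
    | tmul a b =>
      rw [Commute, SemiconjBy, Algebra.TensorProduct.tmul_mul_tmul,
        Algebra.TensorProduct.tmul_mul_tmul, hcomm, hcomm]
  have hg : IsIdempotentElem (e ⊗ₜ[k] e * Coalgebra.comul (R := k) (1 - e)) := by
    refine hE.mul_of_commute (hEcomm _) ?_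
    rw [IsIdempotentElem, ← Bialgebra.comul_mul, he.one_sub.eq]
  have hφ : counitTensorId k H (e ⊗ₜ[k] e * Coalgebra.comul (R := k) (1 - e)) = 0 := by
    rw [map_mul, counitTensorId_comul, counitTensorId_tmul, hcounit, one_smul, mul_sub, mul_one,
      he.eq, sub_self]
  have hg1 : e ⊗ₜ[k] (1 : H) * (e ⊗ₜ[k] e * Coalgebra.comul (R := k) (1 - e)) =
      e ⊗ₜ[k] e * Coalgebra.comul (R := k) (1 - e) := by
    rw [← mul_assoc, Algebra.TensorProduct.tmul_mul_tmul, he.eq, one_mul]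
  refine hg.eq_zero_of_mem_leftTensorSpan (isNilpotent_cornerAugmentation he hcomm hinv) ?_
  have hmem := tmul_one_mul_sub_mem he hcomm hcounit
    (e ⊗ₜ[k] e * Coalgebra.comul (R := k) (1 - e))
  rwa [hφ, hg1, TensorProduct.tmul_zero, sub_zero] at hmem

end LocalCorner

/-- An element of `A ⊗ A` killed by `e ⊗ e` with `e` central lies in `I ⊗ A + A ⊗ I`, where
`I = A(1 - e)`. -/
theorem mem_sup_range_map_of_tmul_mul_eq_zero {R A : Type*} [CommRing R] [Ring A] [Algebra R A]
    {e : A} (hcomm : ∀ x, e * x = x * e) {I : Submodule R A}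
    (hI : I = LinearMap.range (LinearMap.mulRight R (1 - e))) {x : A ⊗[R] A}
    (hx : e ⊗ₜ[R] e * x = 0) :
    x ∈ LinearMap.range (TensorProduct.map I.subtype (LinearMap.id (R := R) (M := A))) ⊔
      LinearMap.range (TensorProduct.map (LinearMap.id (R := R) (M := A)) I.subtype) := by
  have hmem (a : A) : (1 - e) * a ∈ I := by
    rw [hI]
    exact ⟨a, by simp [mul_sub, sub_mul, hcomm]⟩
  have h1 (y : A ⊗[R] A) : (1 - e) ⊗ₜ[R] (1 : A) * y ∈
      LinearMap.range (TensorProduct.map I.subtype (LinearMap.id (R := R) (M := A))) := by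
    induction y with
    | zero => simp
    | add y z hy hz => rw [mul_add]; exact add_mem hy hz
    | tmul a b => exact ⟨⟨_, hmem a⟩ ⊗ₜ b, by simp⟩
  have h2 (y : A ⊗[R] A) : e ⊗ₜ[R] (1 - e) * y ∈
      LinearMap.range (TensorProduct.map (LinearMap.id (R := R) (M := A)) I.subtype) := by
    induction y with
    | zero => simp
    | add y z hy hz => rw [mul_add]; exact add_mem hy hz
    | tmul a b => exact ⟨(e * a) ⊗ₜ ⟨_, hmem b⟩, by simp⟩
  have hsplit : x = (1 - e) ⊗ₜ[R] (1 : A) * x + e ⊗ₜ[R] (1 - e) * x := by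
    have h : (1 - e) ⊗ₜ[R] (1 : A) + e ⊗ₜ[R] (1 - e) = 1 - e ⊗ₜ[R] e := by
      rw [Algebra.TensorProduct.one_def, TensorProduct.sub_tmul, TensorProduct.tmul_sub]
      abel
    rw [← add_mul, h, sub_mul, hx, one_mul, sub_zero]
  rw [hsplit]
  exact Submodule.add_mem_sup (h1 x) (h2 x)

/-- Let `H` be a finite-dimensional Hopf algebra over an algebraically closed field `k`,
and let `e₀` be a central idempotent of `H` with `ε(e₀) = 1`.  Suppose that the ring
`B₀ = He₀` (with identity element `e₀`) is a local ring, expressed intrinsically: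
`B₀` is nonzero and for every `b ∈ B₀`, either `b` or `e₀ - b` is invertible in `B₀`
(i.e. has a two-sided inverse relative to the identity `e₀`).  Then the two-sided ideal
`I = H(1 - e₀)` is a Hopf ideal: `ε(I) = 0`, `Δ(I) ⊆ I ⊗ H + H ⊗ I` and `S(I) ⊆ I`. -/
theorem stmt3 (k H : Type) [Field k] [IsAlgClosed k] [Ring H] [HopfAlgebra k H]
    [FiniteDimensional k H]
    (e₀ : H) (he : IsIdempotentElem e₀) (hecentral : e₀ ∈ Set.center H)
    (hcounit : Coalgebra.counit (R := k) e₀ = 1)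
    -- `He₀` is a local ring (with identity `e₀`)
    (hnontriv : e₀ ≠ 0)
    (hlocal : ∀ b ∈ {y : H | ∃ h : H, y = h * e₀},
      (∃ c ∈ {y : H | ∃ h : H, y = h * e₀}, b * c = e₀ ∧ c * b = e₀) ∨
      (∃ c ∈ {y : H | ∃ h : H, y = h * e₀}, (e₀ - b) * c = e₀ ∧ c * (e₀ - b) = e₀)) :
    -- the ideal `I = H(1 - e₀)`
    ∀ I : Submodule k H, I = LinearMap.range (LinearMap.mulRight k (1 - e₀)) →
      (∀ x ∈ I, Coalgebra.counit (R := k) x = 0) ∧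
      (∀ x ∈ I, Coalgebra.comul (R := k) x ∈
        LinearMap.range (TensorProduct.map I.subtype (LinearMap.id (R := k) (M := H))) ⊔
          LinearMap.range (TensorProduct.map (LinearMap.id (R := k) (M := H)) I.subtype)) ∧
      (∀ x ∈ I, HopfAlgebra.antipode (R := k) x ∈ I) := by
  have hcomm (x : H) : e₀ * x = x * e₀ := (Set.mem_center_iff.1 hecentral).comm x
  have hinv : ∀ b ∈ cornerAugmentation k e₀, ∃ c, c * e₀ = c ∧ c * (e₀ - b) = e₀ := by
    intro b hb
    obtain ⟨hbe, hb0⟩ := (mem_cornerAugmentation he).1 hb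
    rcases hlocal b ⟨b, hbe.symm⟩ with ⟨c, -, hc, -⟩ | ⟨c, ⟨d, rfl⟩, -, hc⟩
    · have := congrArg (Coalgebra.counit (R := k)) hc
      rw [Bialgebra.counit_mul, hb0, hcounit, zero_mul] at this
      exact absurd this zero_ne_one
    · exact ⟨_, by rw [mul_assoc, he.eq], hc⟩
  rintro I hI
  refine ⟨?_, ?_, ?_⟩
  · intro x hx
    rw [hI] at hx
    obtain ⟨h, rfl⟩ := hx
    simp [Bialgebra.counit_mul, hcounit]
  · intro x hx
    refine mem_sup_range_map_of_tmul_mul_eq_zero hcomm hI ?_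
    rw [hI] at hx
    obtain ⟨h, rfl⟩ := hx
    have hswap : LinearMap.mulRight k (1 - e₀) h = (1 - e₀) * h := by
      simp [mul_sub, sub_mul, hcomm]
    rw [hswap, Bialgebra.comul_mul, ← mul_assoc, tmul_mul_comul_eq he hcomm hcounit hinv, zero_mul]
  · have hSe : IsIdempotentElem (HopfAlgebra.antipode k e₀) := by
      rw [IsIdempotentElem, ← HopfAlgebra.antipode_mul_antidistrib, he.eq]
    have hb : IsIdempotentElem (e₀ * (1 - HopfAlgebra.antipode k e₀)) :=
      he.mul_of_commute (hcomm _) hSe.one_sub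
    have hbJ : e₀ * (1 - HopfAlgebra.antipode k e₀) ∈ cornerAugmentation k e₀ := by
      rw [mem_cornerAugmentation he]
      refine ⟨by rw [← hcomm, ← mul_assoc, he.eq], ?_⟩
      simp [Bialgebra.counit_mul, hcounit]
    obtain ⟨c, -, hc⟩ := hinv _ hbJ
    have hzero := hb.eq_zero_of_mul_sub_eq (by rw [← mul_assoc, he.eq]) hc
    intro x hx
    rw [hI] at hx ⊢
    obtain ⟨h, rfl⟩ := hx
    refine ⟨HopfAlgebra.antipode k (h * (1 - e₀)), ?_⟩
    rw [LinearMap.mulRight_apply, LinearMap.mulRight_apply, mul_sub, mul_one, ← hcomm,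
      HopfAlgebra.antipode_mul_antidistrib, map_sub, HopfAlgebra.antipode_one, ← mul_assoc, hzero,
      zero_mul, sub_zero]
end

section
/- Let k be an algebraically closed field of characteristic p > 0, G a non-abelian finite p-group, and g₁ a central element of G of order p. In the group algebra kG set x = 1 − g₁, N = Σ_{g ∈ G} g, and u = x + N. Then: (i) uᵖ = 0, so t ↦ u defines a k-algebra homomorphism α: k[t]/(tᵖ) → kG; (ii) kG, regarded as a k[t]/(tᵖ)-module via α and left multiplication, is free; and (iii) for every proper subgroup H of G, u does not lie in the k-linear span of H inside kG. In particular α is a flat map which does not factor through the group algebra of any proper subgroup of G. -/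
/-- The algebra `k[t]/(tᵖ)`. -/
noncomputable abbrev Kt (k : Type) [Field k] (p : ℕ) : Type :=
  Polynomial k ⧸ Ideal.span {(Polynomial.X : Polynomial k) ^ p}

/-- The class of `t` in `k[t]/(tᵖ)`. -/
noncomputable def KtGen (k : Type) [Field k] (p : ℕ) : Kt k p :=
  Ideal.Quotient.mk _ (Polynomial.X : Polynomial k)

open scoped TensorProduct

/-- Over a commutative local ring whose maximal ideal is generated by `t` with `t ^ (n + 1) = 0`, a
finitely presented module in which `t • m = 0` forces `m ∈ t ^ n • M` is free. -/
theorem Module.free_of_maximalIdeal_eq_span_of_torsion {A M : Type*} [CommRing A] [IsLocalRing A]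
    [AddCommGroup M] [Module A M] [Module.FinitePresentation A M] {t : A} {n : ℕ}
    (hmax : IsLocalRing.maximalIdeal A = Ideal.span {t}) (ht : t ^ (n + 1) = 0)
    (h : ∀ m : M, t • m = 0 → ∃ s : M, m = t ^ n • s) : Module.Free A M := by
  apply Module.free_of_maximalIdeal_rTensor_injective
  have htm : t ∈ IsLocalRing.maximalIdeal A := hmax ▸ Ideal.mem_span_singleton_self t
  have key : ∀ z : IsLocalRing.maximalIdeal A ⊗[A] M,
      ∃ m : M, z = (⟨t, htm⟩ : IsLocalRing.maximalIdeal A) ⊗ₜ[A] m := by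
    intro z
    induction z with
    | zero => exact ⟨0, by simp⟩
    | tmul a m =>
      obtain ⟨a, ha⟩ := a
      obtain ⟨b, rfl⟩ := Ideal.mem_span_singleton'.1 (hmax ▸ ha)
      refine ⟨b • m, ?_⟩
      rw [← TensorProduct.smul_tmul]
      rfl
    | add x y hx hy =>
      obtain ⟨m, rfl⟩ := hx
      obtain ⟨m', rfl⟩ := hy
      exact ⟨m + m', by rw [TensorProduct.tmul_add]⟩
  rw [injective_iff_map_eq_zero]
  intro z hz
  obtain ⟨m, rfl⟩ := key z
  have hm : t • m = 0 := by
    have := congrArg (TensorProduct.lid A M) hz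
    simpa using this
  obtain ⟨s, rfl⟩ := h m hm
  rw [← TensorProduct.smul_tmul]
  have h0 : t ^ n • (⟨t, htm⟩ : IsLocalRing.maximalIdeal A) = 0 :=
    Subtype.ext (by simpa [pow_succ] using ht)
  rw [h0, TensorProduct.zero_tmul]

theorem Ideal.eq_of_isMaximal_span_of_pow_eq_zero {A : Type*} [CommRing A] {t : A} {n : ℕ}
    (ht : t ^ n = 0) (hmax : (Ideal.span {t}).IsMaximal) (J : Ideal A) (hJ : J.IsMaximal) :
    J = Ideal.span {t} := by
  refine (hmax.eq_of_le hJ.ne_top ?_).symm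
  rw [Ideal.span_singleton_le_iff_mem]
  exact hJ.isPrime.mem_of_pow_mem n (ht ▸ J.zero_mem)

theorem ktGen_pow (k : Type) [Field k] (p : ℕ) : KtGen k p ^ p = 0 := by
  rw [KtGen, ← map_pow]
  exact Ideal.Quotient.eq_zero_iff_mem.2 (Ideal.mem_span_singleton_self _)

theorem isMaximal_span_ktGen (k : Type) [Field k] {p : ℕ} (hp : p ≠ 0) :
    (Ideal.span {KtGen k p}).IsMaximal := by
  have hX : (Ideal.span {(Polynomial.X : Polynomial k)}).IsMaximal :=
    PrincipalIdealRing.isMaximal_of_irreducible Polynomial.irreducible_X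
  have hle : Ideal.span {(Polynomial.X : Polynomial k) ^ p} ≤
      Ideal.span {(Polynomial.X : Polynomial k)} :=
    Ideal.span_singleton_le_span_singleton.2 (dvd_pow_self _ hp)
  have h := Ideal.map_eq_top_or_isMaximal_of_surjective
    (Ideal.Quotient.mk (Ideal.span {(Polynomial.X : Polynomial k) ^ p}))
    Ideal.Quotient.mk_surjective hX
  have hmap := Ideal.map_span (Ideal.Quotient.mk (Ideal.span {(Polynomial.X : Polynomial k) ^ p}))
    {Polynomial.X}
  rw [Set.image_singleton] at hmap
  rw [KtGen, ← hmap]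
  refine h.resolve_left fun htop => hX.ne_top ?_
  have hc := congrArg (Ideal.comap
    (Ideal.Quotient.mk (Ideal.span {(Polynomial.X : Polynomial k) ^ p}))) htop
  rwa [Ideal.comap_map_of_surjective _
    Ideal.Quotient.mk_surjective, ← RingHom.ker_eq_comap_bot, Ideal.mk_ker, sup_eq_left.2 hle,
    Ideal.comap_top] at hc

theorem isLocalRing_kt (k : Type) [Field k] {p : ℕ} (hp : p ≠ 0) : IsLocalRing (Kt k p) :=
  .of_unique_max_ideal ⟨_, isMaximal_span_ktGen k hp,
    Ideal.eq_of_isMaximal_span_of_pow_eq_zero (ktGen_pow k p) (isMaximal_span_ktGen k hp)⟩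

/-- If left multiplication by `u` on `R` has kernel inside `u ^ (p - 1) R`, then `R` is free over
`k[t]/(tᵖ)` via `t ↦ u`. -/
theorem free_compHom_kt {k : Type} [Field k] {R : Type*} [Ring R] [Algebra k R] [Module.Finite k R]
    {n : ℕ} {u : R} (α : Kt k (n + 1) →ₐ[k] R) (hα : α (KtGen k (n + 1)) = u)
    (h : ∀ m : R, u * m = 0 → ∃ s : R, m = u ^ n * s) :
    letI : Module (Kt k (n + 1)) R := Module.compHom R α.toRingHom
    Module.Free (Kt k (n + 1)) R := by
  let _ : Module (Kt k (n + 1)) R := Module.compHom R α.toRingHom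
  have hsmul (a : Kt k (n + 1)) (m : R) : a • m = α a * m := rfl
  have : IsScalarTower k (Kt k (n + 1)) R :=
    .of_algebraMap_smul fun r m => by rw [hsmul, AlgHom.commutes, Algebra.smul_def]
  have : Module.Finite (Kt k (n + 1)) R := Module.Finite.of_restrictScalars_finite k _ _
  have : Module.FinitePresentation (Kt k (n + 1)) R := Module.finitePresentation_of_finite _ _
  have := isLocalRing_kt k n.succ_ne_zero
  refine Module.free_of_maximalIdeal_eq_span_of_torsion
    (Ideal.eq_of_isMaximal_span_of_pow_eq_zero (ktGen_pow k (n + 1))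
      (isMaximal_span_ktGen k n.succ_ne_zero) _ inferInstance) (ktGen_pow k (n + 1)) ?_
  intro m hm
  rw [hsmul, hα] at hm
  obtain ⟨s, hs⟩ := h m hm
  exact ⟨s, by rw [hsmul, map_pow, hα, hs]⟩

theorem add_pow_succ_of_mul_eq_zero {R : Type*} [Ring R] {x y : R} (hxy : x * y = 0)
    (hyx : y * x = 0) (n : ℕ) : (x + y) ^ (n + 1) = x ^ (n + 1) + y ^ (n + 1) := by
  induction n with
  | zero => simp
  | succ n ih =>
    rw [pow_succ, ih, mul_add, add_mul, add_mul, pow_succ x n, pow_succ y n, mul_assoc _ y x, hyx,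
      mul_assoc _ x y, hxy, pow_succ x (n + 1), pow_succ y (n + 1), pow_succ x n, pow_succ y n]
    simp

/-- Perturbing `x` by a central `N = x ^ (n + 1) T` with `x N = N T = 0` preserves the
property that the annihilator is generated by the `(n + 1)`-st power. -/
theorem exists_eq_add_pow_mul {R : Type*} [Ring R] {x N T : R} {n : ℕ}
    (hN : ∀ r, N * r = r * N) (hxN : x * N = 0) (hNT : N * T = 0)
    (hT : N = x ^ (n + 1) * T) (hker : ∀ m, x * m = 0 → ∃ s, m = x ^ (n + 1) * s)
    (m : R) (hm : (x + N) * m = 0) : ∃ s, m = (x + N) ^ (n + 1) * s := by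
  have hNx : N * x = 0 := by rw [hN, hxN]
  have hNxn : N * x ^ (n + 1) = 0 := by rw [pow_succ', ← mul_assoc, hNx, zero_mul]
  have hxm : x * (m + x ^ n * T * m) = 0 := by
    rw [mul_add, ← mul_assoc, ← mul_assoc, ← pow_succ', ← hT, ← add_mul, hm]
  obtain ⟨s, hs⟩ := hker _ hxm
  have hNm : N * m = 0 := by
    have h1 : N * (x ^ n * T * m) = 0 := by
      rw [← mul_assoc, ← mul_assoc, hN (x ^ n), mul_assoc (x ^ n), hNT, mul_zero, zero_mul]
    have h2 := congrArg (N * ·) hs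
    simpa only [mul_add, h1, add_zero, ← mul_assoc, hNxn, zero_mul] using h2
  have hxm' : x * m = 0 := by simpa only [add_mul, hNm, add_zero] using hm
  obtain ⟨r, rfl⟩ := hker m hxm'
  have hpow := add_pow_succ_of_mul_eq_zero hxN hNx n
  have hNT' : N ^ (n + 1) * T = 0 := by rw [pow_succ, mul_assoc, hNT, mul_zero]
  have hu : N = (x + N) ^ (n + 1) * T := by rw [hpow, add_mul, hNT', add_zero, ← hT]
  have hNr : N ^ (n + 1) * r = (x + N) ^ (n + 1) * (T * (N ^ n * r)) := by
    rw [← mul_assoc _ T, ← hu, ← mul_assoc, ← pow_succ']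
  exact ⟨r - T * (N ^ n * r), by rw [mul_sub, ← hNr, hpow, add_mul, add_sub_cancel_right]⟩

/-- In characteristic `p`, `(1 - g) ^ (p - 1) = 1 + g + ⋯ + g ^ (p - 1)`. -/
theorem one_sub_pow_eq_geom_sum {k R : Type*} [Field k] [Ring R] [Algebra k R] {n : ℕ}
    [Fact (n + 1).Prime] [CharP k (n + 1)] (g : R) :
    (1 - g) ^ n = ∑ i ∈ Finset.range (n + 1), g ^ i := by
  have h : ((1 : Polynomial k) - Polynomial.X) ^ n =
      ∑ i ∈ Finset.range (n + 1), Polynomial.X ^ i := by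
    have h0 : (1 : Polynomial k) - Polynomial.X ≠ 0 := by
      rw [sub_ne_zero]; exact Polynomial.X_ne_C (1 : k) |>.symm
    refine mul_left_cancel₀ h0 ?_
    rw [← pow_succ', mul_neg_geom_sum, sub_pow_char (p := n + 1), one_pow]
  simpa using congrArg (Polynomial.aeval g) h

section GroupAlgebra

open MonoidAlgebra

variable {k G : Type} [Field k] [Group G]

theorem MonoidAlgebra.sum_of_coeff [Fintype G] (m : MonoidAlgebra k G) :
    m = ∑ g : G, m.coeff g • of k G g := by
  classical
  ext h
  simp

/-- An element of the group algebra invariant under a central `g₁` of order `n + 1` is the orbit sum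
of its restriction to a set of representatives. -/
theorem MonoidAlgebra.eq_geom_sum_mul_of_invariant [Fintype G] {n : ℕ} {g₁ : G}
    (hg₁ : g₁ ∈ Subgroup.center G) (horder : orderOf g₁ = n + 1) {m : MonoidAlgebra k G}
    (hm : of k G g₁ * m = m) [Fintype (G ⧸ Subgroup.zpowers g₁)] :
    m = (∑ i ∈ Finset.range (n + 1), of k G g₁ ^ i) *
      ∑ q : G ⧸ Subgroup.zpowers g₁, m.coeff q.out • of k G q.out := by
  classical
  have hinv (g : G) : m.coeff (g₁ * g) = m.coeff g := by
    conv_lhs => rw [← hm]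
    rw [of_apply, coeff_single_mul_apply]
    simp
  have hinv' (i : ℕ) (g : G) : m.coeff (g₁ ^ i * g) = m.coeff g := by
    induction i with
    | zero => simp
    | succ i ih => rw [pow_succ', mul_assoc, hinv, ih]
  have hcomm (i : ℕ) (g : G) : g₁ ^ i * g = g * g₁ ^ i :=
    (Subgroup.mem_center_iff.1 (pow_mem hg₁ i) g).symm
  have hbij : Function.Bijective
      (fun z : Fin (n + 1) × (G ⧸ Subgroup.zpowers g₁) => g₁ ^ (z.1 : ℕ) * z.2.out) := by
    constructor
    · rintro ⟨i, q⟩ ⟨j, r⟩ h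
      simp only [hcomm] at h
      have hq (i : ℕ) (q : G ⧸ Subgroup.zpowers g₁) :
          ((q.out * g₁ ^ i : G) : G ⧸ Subgroup.zpowers g₁) = q := by
        rw [QuotientGroup.mk_mul_of_mem _ (pow_mem (Subgroup.mem_zpowers g₁) i)]
        exact Quotient.out_eq' q
      have hqr : q = r := by rw [← hq i q, h, hq j r]
      subst hqr
      have hij := mul_left_cancel h
      have := pow_injOn_Iio_orderOf (x := g₁) (by simpa [horder] using i.2)
        (by simpa [horder] using j.2) hij
      rw [Fin.ext this]
    · intro g
      obtain ⟨⟨_, z, rfl⟩, hz⟩ := QuotientGroup.mk_out_eq_mul (Subgroup.zpowers g₁) g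
      have hz' : g₁ ^ (-z) ∈ Submonoid.powers g₁ := by
        rw [mem_powers_iff_mem_zpowers]; exact ⟨-z, rfl⟩
      rw [mem_powers_iff_mem_range_orderOf, horder] at hz'
      obtain ⟨i, hi, hiz⟩ := Finset.mem_image.1 hz'
      refine ⟨⟨⟨i, Finset.mem_range.1 hi⟩, g⟩, ?_⟩
      simp only [hcomm]
      rw [hiz, hz]
      simp
  conv_lhs => rw [MonoidAlgebra.sum_of_coeff m]
  rw [← hbij.sum_comp (fun g => m.coeff g • of k G g), Fintype.sum_prod_type, Finset.sum_mul,
    ← Fin.sum_univ_eq_sum_range (fun i => of k G g₁ ^ i * _)]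
  refine Finset.sum_congr rfl fun i _ => ?_
  rw [Finset.mul_sum]
  refine Finset.sum_congr rfl fun q _ => ?_
  simp only [hinv', map_mul, map_pow, mul_smul_comm]

theorem MonoidAlgebra.of_mul_sum_of [Fintype G] (h : G) :
    of k G h * ∑ g : G, of k G g = ∑ g : G, of k G g := by
  rw [Finset.mul_sum]
  simp only [← map_mul]
  exact Equiv.sum_comp (Equiv.mulLeft h) (fun g => of k G g)

theorem MonoidAlgebra.sum_of_mul_of [Fintype G] (h : G) :
    (∑ g : G, of k G g) * of k G h = ∑ g : G, of k G g := by
  rw [Finset.sum_mul]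
  simp only [← map_mul]
  exact Equiv.sum_comp (Equiv.mulRight h) (fun g => of k G g)

theorem MonoidAlgebra.sum_of_mul_comm [Fintype G] (r : MonoidAlgebra k G) :
    (∑ g : G, of k G g) * r = r * ∑ g : G, of k G g := by
  rw [MonoidAlgebra.sum_of_coeff r]
  simp only [Finset.mul_sum (s := Finset.univ) (f := fun g => r.coeff g • of k G g),
    Finset.sum_mul (s := Finset.univ) (f := fun g => r.coeff g • of k G g),
    mul_smul_comm, smul_mul_assoc, sum_of_mul_of, of_mul_sum_of]

theorem MonoidAlgebra.coeff_eq_zero_of_mem_span {S : Set G} {r : MonoidAlgebra k G}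
    (hr : r ∈ Submodule.span k (⇑(of k G) '' S)) {g : G} (hg : g ∉ S) : r.coeff g = 0 := by
  induction hr using Submodule.span_induction with
  | mem x hx =>
    obtain ⟨h, hh, rfl⟩ := hx
    have : h ≠ g := fun e => hg (e ▸ hh)
    simp [this]
  | zero => simp
  | add x y _ _ hx hy => simp [hx, hy]
  | smul a x _ hx => simp [hx]

/-- If the complement of a proper subgroup is contained in a singleton, the group has at most two
elements, and hence is commutative. -/
theorem Subgroup.mul_comm_of_forall_notMem_eq {H : Subgroup G} (hH : H ≠ ⊤) {c : G}
    (h : ∀ g, g ∉ H → g = c) (a b : G) : a * b = b * a := by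
  have hc : c ∉ H := fun hc => hH <| (eq_top_iff' H).2 fun g => by
    by_contra hg
    exact hg (h g hg ▸ hc)
  have hbot (x : G) (hx : x ∈ H) : x = 1 := by
    have := h (x * c) fun hxc => hc ((H.mul_mem_cancel_left hx).1 hxc)
    simpa using this
  have hall (x : G) : x = 1 ∨ x = c := (em (x ∈ H)).imp (hbot x) (h x)
  rcases hall a with rfl | rfl <;> rcases hall b with rfl | rfl <;> simp

theorem dvd_card_quotient_zpowers {p : ℕ} [Fact p.Prime] [Finite G] (hpG : IsPGroup p G)
    (hnonab : ¬ ∀ a b : G, a * b = b * a) (g : G) :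
    p ∣ Nat.card (G ⧸ Subgroup.zpowers g) := by
  obtain ⟨n, hn⟩ := hpG.index (Subgroup.zpowers g)
  rw [Subgroup.index] at hn
  rcases n.eq_zero_or_pos with rfl | hpos
  · refine absurd (fun a b => ?_) hnonab
    have htop : Subgroup.zpowers g = ⊤ := Subgroup.index_eq_one.1 (by simpa [Subgroup.index] using hn)
    obtain ⟨i, rfl⟩ : a ∈ Subgroup.zpowers g := htop ▸ Subgroup.mem_top a
    obtain ⟨j, rfl⟩ : b ∈ Subgroup.zpowers g := htop ▸ Subgroup.mem_top b
    exact (zpow_mul_comm g i j)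
  · exact hn ▸ dvd_pow_self p hpos.ne'

end GroupAlgebra

/-- Let `G` be a non-abelian finite `p`-group over an algebraically closed field `k` of
characteristic `p`, and `g₁` a central element of order `p`.  With `x = 1 - g₁`,
`N = ∑_{g ∈ G} g` and `u = x + N` in `kG`: (i) `uᵖ = 0`, so `t ↦ u` defines an algebra
map `α : k[t]/(tᵖ) → kG`; (ii) `kG` is free as a `k[t]/(tᵖ)`-module via `α` and left
multiplication; (iii) `u` lies in the `k`-linear span of no proper subgroup of `G`. -/
theorem stmt6 (k : Type) [Field k] [IsAlgClosed k] (p : ℕ) [Fact p.Prime] [CharP k p]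
    (G : Type) [Group G] [Fintype G] (hpG : IsPGroup p G)
    (hnonab : ¬ ∀ a b : G, a * b = b * a)
    (g₁ : G) (hg₁ : g₁ ∈ Subgroup.center G) (horder : orderOf g₁ = p)
    (u : MonoidAlgebra k G)
    (hu : u = (1 - MonoidAlgebra.of k G g₁) + ∑ g : G, MonoidAlgebra.of k G g) :
    u ^ p = 0 ∧
    (∃ α : Kt k p →ₐ[k] MonoidAlgebra k G, α (KtGen k p) = u ∧
      (letI : Module (Kt k p) (MonoidAlgebra k G) :=
        Module.compHom (MonoidAlgebra k G) α.toRingHom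
       Module.Free (Kt k p) (MonoidAlgebra k G))) ∧
    ∀ H : Subgroup G, H ≠ ⊤ →
      u ∉ Submodule.span k (⇑(MonoidAlgebra.of k G) '' (H : Set G)) := by
  classical
  obtain ⟨n, rfl⟩ : ∃ n, p = n + 2 := ⟨p - 2, by have := (Fact.out : p.Prime).two_le; omega⟩
  set g : MonoidAlgebra k G := MonoidAlgebra.of k G g₁ with hg
  set N : MonoidAlgebra k G := ∑ g : G, MonoidAlgebra.of k G g with hNdef
  let _ : Fintype (G ⧸ Subgroup.zpowers g₁) := Fintype.ofFinite _
  set T : MonoidAlgebra k G :=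
    ∑ q : G ⧸ Subgroup.zpowers g₁, MonoidAlgebra.of k G q.out with hTdef
  have hN (r) : N * r = r * N := MonoidAlgebra.sum_of_mul_comm r
  have hgN : g * N = N := MonoidAlgebra.of_mul_sum_of g₁
  have hxN : (1 - g) * N = 0 := by rw [sub_mul, one_mul, hgN, sub_self]
  have hNT : N * T = 0 := by
    rw [hTdef, Finset.mul_sum]
    simp only [hNdef, MonoidAlgebra.sum_of_mul_of]
    rw [Finset.sum_const, Finset.card_univ, ← Nat.card_eq_fintype_card, ← Nat.cast_smul_eq_nsmul k,
      (CharP.cast_eq_zero_iff k (n + 2) _).2 (dvd_card_quotient_zpowers hpG hnonab g₁), zero_smul]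
  have hxpow : (1 - g) ^ (n + 1) = ∑ i ∈ Finset.range (n + 2), g ^ i :=
    one_sub_pow_eq_geom_sum (k := k) g
  have hNcoeff (a : G) : N.coeff a = 1 := by
    simp [hNdef, Finsupp.single_apply]
  have hT : N = (1 - g) ^ (n + 1) * T := by
    have := MonoidAlgebra.eq_geom_sum_mul_of_invariant hg₁ horder hgN
    simp only [hNcoeff, one_smul] at this
    rw [hxpow]
    exact this
  have hker (m) (hm : (1 - g) * m = 0) : ∃ s, m = (1 - g) ^ (n + 1) * s := by
    rw [sub_mul, one_mul, sub_eq_zero] at hm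
    rw [hxpow]
    exact ⟨_, MonoidAlgebra.eq_geom_sum_mul_of_invariant hg₁ horder hm.symm⟩
  have hgp : g ^ (n + 2) = 1 := by rw [hg, ← map_pow, ← horder, pow_orderOf_eq_one, map_one]
  have hxp : (1 - g) ^ (n + 2) = 0 := by
    rw [pow_succ', hxpow, mul_neg_geom_sum, hgp, sub_self]
  have hN2 : N * N = 0 := by
    conv_lhs => enter [1]; rw [hT]
    rw [mul_assoc, ← hN, hNT, mul_zero]
  have hup : u ^ (n + 2) = 0 := by
    rw [hu, add_pow_succ_of_mul_eq_zero hxN (by rw [hN, hxN]), hxp, pow_succ, pow_succ, mul_assoc,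
      hN2, mul_zero, add_zero]
  refine ⟨hup, ?_, fun H hH hmem => ?_⟩
  · let α : Kt k (n + 2) →ₐ[k] MonoidAlgebra k G :=
      Ideal.Quotient.liftₐ _ (Polynomial.aeval u) fun a ha => by
        obtain ⟨b, rfl⟩ := Ideal.mem_span_singleton'.1 ha
        simp [hup]
    have hα : α (KtGen k (n + 2)) = u :=
      (Ideal.Quotient.lift_mk _ _ _).trans (Polynomial.aeval_X u)
    refine ⟨α, hα, free_compHom_kt α hα fun m hm => ?_⟩
    rw [hu] at hm ⊢
    exact exists_eq_add_pow_mul hN hxN hNT hT hker m hm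
  · refine hnonab (Subgroup.mul_comm_of_forall_notMem_eq hH (c := g₁) fun a ha => ?_)
    by_contra hne
    have h0 := MonoidAlgebra.coeff_eq_zero_of_mem_span hmem (g := a) ha
    have h1 : (1 : G) ≠ a := fun e => ha (e ▸ H.one_mem)
    rw [hu, MonoidAlgebra.coeff_add, MonoidAlgebra.coeff_sub, Finsupp.add_apply,
      Finsupp.sub_apply, hNcoeff, hg, MonoidAlgebra.of_apply, MonoidAlgebra.one_def,
      MonoidAlgebra.coeff_single, MonoidAlgebra.coeff_single, Finsupp.single_eq_of_ne h1.symm,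
      Finsupp.single_eq_of_ne hne] at h0
    simp at h0
end

section
/- Let k be an algebraically closed field of characteristic p > 0, G a finite group, e a primitive central idempotent of kG, and B = kGe the corresponding block. Let α and β be p-points of G, i.e. flat k-algebra homomorphisms k[t]/(tᵖ) → kG whose images are contained in kH for some abelian p-subgroups H of G. Assume there exist finitely generated kG-modules M₁ and M₂ lying in B such that α*(M₁) and β*(M₂) are not projective. If for every finitely generated kG-module N lying in B one has α*(N) projective if and only if β*(N) projective, then for every finitely generated kG-module N (not necessarily lying in B) one has α*(N) projective if and only if β*(N) projective. -/
open TensorProduct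

/-- A `k`-algebra homomorphism `α : k[t]/(tᵖ) → A` is flat if `A`, regarded as a
`k[t]/(tᵖ)`-module via `α` and left multiplication, is projective. -/
def IsFlatAlgHom {k : Type} [Field k] {p : ℕ} {A : Type} [Ring A] [Algebra k A]
    (α : Kt k p →ₐ[k] A) : Prop :=
  letI : Module (Kt k p) A := Module.compHom A α.toRingHom
  Module.Projective (Kt k p) A

/-- `α*(M)` is a projective `k[t]/(tᵖ)`-module. -/
def PullbackProjective {k : Type} [Field k] {p : ℕ} {A : Type} [Ring A] [Algebra k A]
    (α : Kt k p →ₐ[k] A) (M : Type) [AddCommGroup M] [Module A M] : Prop :=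
  letI : Module (Kt k p) M := Module.compHom M α.toRingHom
  Module.Projective (Kt k p) M

/-- A `p`-point of a finite group `G`: a flat `k`-algebra homomorphism
`k[t]/(tᵖ) → kG` whose image is contained in the subalgebra `kH` (the `k`-linear span
of `H`) for some abelian `p`-subgroup `H ≤ G`. -/
def IsPPoint {k : Type} [Field k] {p : ℕ} {G : Type} [Group G]
    (α : Kt k p →ₐ[k] MonoidAlgebra k G) : Prop :=
  IsFlatAlgHom α ∧
    ∃ H : Subgroup G, IsPGroup p H ∧ (∀ a b : H, a * b = b * a) ∧
      ∀ c : Kt k p, α c ∈ Submodule.span k (⇑(MonoidAlgebra.of k G) '' (H : Set G))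

/-- The action of `u` on `M` satisfies `ker u ⊆ im u^(p-1)`. For an algebra over a field and
`u ^ p = 0`, this says that `M` is free over the truncated polynomial algebra in `u`. -/
def KerLeRangePow {A : Type*} [Ring A] (p : ℕ) (u : A) (M : Type*) [AddCommGroup M]
    [Module A M] : Prop :=
  ∀ m : M, u • m = 0 → ∃ n : M, u ^ (p - 1) • n = m

namespace KerLeRangePow

section Ring

variable {A : Type*} [Ring A] {p : ℕ} {M : Type*} [AddCommGroup M] [Module A M]

lemma exists_smul_eq_of_pow_smul_eq_zero {u : A} (h : KerLeRangePow p u M) {j : ℕ}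
    (hj : j < p) {m : M} (hm : u ^ j • m = 0) : ∃ n : M, u ^ (p - j) • n = m := by
  induction j generalizing m with
  | zero => exact ⟨0, by simpa using hm.symm⟩
  | succ j ih =>
    obtain ⟨n, hn⟩ := h (u ^ j • m) (by rw [smul_smul, ← pow_succ', hm])
    have hpow : u ^ (p - 1) = u ^ j * u ^ (p - (j + 1)) := by
      rw [← pow_add]; congr 1; omega
    obtain ⟨l, hl⟩ := ih (m := m - u ^ (p - (j + 1)) • n) (by omega) (by
      rw [smul_sub, smul_smul, ← hpow, hn, sub_self])
    refine ⟨n + u • l, ?_⟩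
    rw [smul_add, smul_smul, ← pow_succ, show p - (j + 1) + 1 = p - j by omega, hl]
    abel

end Ring

end KerLeRangePow

section Shift

variable {M : Type*} [AddCommGroup M]

/-- The right shift on sequences, inserting `0` in front. -/
def seqShift (M : Type*) [AddCommGroup M] : AddMonoid.End (ℕ → M) where
  toFun y n := n.casesOn 0 y
  map_zero' := by ext n; cases n <;> rfl
  map_add' y z := by ext n; cases n <;> simp

@[simp] lemma seqShift_apply_zero (y : ℕ → M) : seqShift M y 0 = 0 := rfl

@[simp] lemma seqShift_apply_succ (y : ℕ → M) (n : ℕ) : seqShift M y (n + 1) = y n := rfl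

lemma seqShift_injective : Function.Injective (seqShift M) := fun y z h => by
  ext n
  simpa using congrFun h (n + 1)

lemma eq_seqShift_of_apply_zero {y : ℕ → M} (h : y 0 = 0) :
    y = seqShift M (fun n => y (n + 1)) := by
  ext n; cases n <;> simp [h]

variable {A : Type*} [Ring A] [Module A M]

/-- `u` acting termwise on sequences. -/
def seqSMul (M : Type*) [AddCommGroup M] {A : Type*} [Ring A] [Module A M] :
    A →+* AddMonoid.End (ℕ → M) :=
  Module.toAddMonoidEnd A (ℕ → M)

@[simp] lemma seqSMul_apply (u : A) (y : ℕ → M) (n : ℕ) : seqSMul M u y n = u • y n := rfl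

lemma commute_seqShift_seqSMul (u : A) : Commute (seqShift M) (seqSMul M u) := by
  ext y n; cases n <;> simp

/-- Evaluate the power series `∑ yₙ sⁿ` at `s = f`, where `f ^ N = 0`. -/
def seqEval (M : Type*) [AddCommGroup M] {A : Type*} [Ring A] [Module A M] (f : A) (N : ℕ) :
    (ℕ → M) →+ M where
  toFun y := ∑ n ∈ Finset.range N, f ^ n • y n
  map_zero' := by simp
  map_add' y z := by simp [Finset.sum_add_distrib]

lemma seqEval_seqShift {f : A} {N : ℕ} (hf : f ^ N = 0) (y : ℕ → M) :
    seqEval M f N (seqShift M y) = f • seqEval M f N y := by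
  cases N with
  | zero =>
    have : Subsingleton A := subsingleton_of_zero_eq_one (by simpa using hf.symm)
    have : Subsingleton M := Module.subsingleton A M
    exact Subsingleton.elim _ _
  | succ N =>
    simp only [seqEval, AddMonoidHom.coe_mk, ZeroHom.coe_mk, Finset.smul_sum]
    rw [Finset.sum_range_succ', Finset.sum_range_succ]
    simp [smul_smul, ← pow_succ', hf]

lemma seqEval_seqSMul {f u : A} (h : Commute f u) (N : ℕ) (y : ℕ → M) :
    seqEval M f N (seqSMul M u y) = u • seqEval M f N y := by
  simp [seqEval, Finset.smul_sum, smul_smul, (h.pow_left _).eq]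

end Shift

namespace KerLeRangePow

variable {A : Type*} [Ring A] {p : ℕ} {M : Type*} [AddCommGroup M] [Module A M]

/-- Exactness of `u` on `M` lifts to exactness of `u + s q` on `M[[s]]`. -/
lemma seq {u : A} (hp : p ≠ 0) (h : KerLeRangePow p u M) (q : AddMonoid.End (ℕ → M))
    (hq : Commute q (seqShift M)) (hP : (seqSMul M u + seqShift M * q) ^ p = 0) :
    KerLeRangePow p (seqSMul M u + seqShift M * q) (ℕ → M) := by
  intro y hy
  set s := seqShift M with hs
  set P := seqSMul M u + s * q with hPdef
  have hPs : Commute P s := ((commute_seqShift_seqSMul u).symm).add_left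
    ((Commute.refl s).mul_left hq)
  have hP0 : ∀ (j : ℕ) (z : ℕ → M), (P ^ j) z 0 = u ^ j • z 0 := by
    intro j
    induction j with
    | zero => simp
    | succ j ih =>
      intro z
      rw [pow_succ', pow_succ', mul_smul, ← ih]
      change seqSMul M u ((P ^ j) z) 0 + s (q ((P ^ j) z)) 0 = _
      simp only [seqSMul_apply, hs, seqShift_apply_zero, add_zero]
  have hex : ∀ z : {z : ℕ → M // P z = 0}, ∃ (n : M) (z' : {z : ℕ → M // P z = 0}),
      z.1 = (P ^ (p - 1)) (Pi.single 0 n) + s z'.1 := by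
    rintro ⟨z, hz⟩
    obtain ⟨n, hn⟩ := h (z 0) (by simpa [hz] using (hP0 1 z).symm)
    have h0 : (z - (P ^ (p - 1)) (Pi.single 0 n)) 0 = 0 := by
      rw [Pi.sub_apply, hP0, Pi.single_eq_same, hn, sub_self]
    have hz' := eq_seqShift_of_apply_zero h0
    refine ⟨n, ⟨_, seqShift_injective ?_⟩, eq_add_of_sub_eq' hz'⟩
    change (s * P) _ = _
    rw [← hPs.eq, map_zero]
    change P (s _) = 0
    rw [hs, ← hz', map_sub, hz, zero_sub, neg_eq_zero]
    change (P * P ^ (p - 1)) _ = 0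
    rw [mul_pow_sub_one hp, hP]
    rfl
  choose w nx hw using hex
  let Y : ℕ → {z : ℕ → M // P z = 0} := fun n => nx^[n] ⟨y, hy⟩
  let W : ℕ → ℕ → M := fun m j => w (Y (j + m))
  have hW : ∀ m, W m = Pi.single 0 (w (Y m)) + s (W (m + 1)) := by
    intro m
    ext j
    cases j with
    | zero => simp [W, hs]
    | succ j => simp [W, hs, show j + 1 + m = j + (m + 1) by omega]
  have hY : ∀ m, (Y m).1 = (P ^ (p - 1)) (Pi.single 0 (w (Y m))) + s (Y (m + 1)).1 := by
    intro m
    rw [show Y (m + 1) = nx (Y m) from Function.iterate_succ_apply' _ _ _]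
    exact hw _
  have key : ∀ m, (Y m).1 - (P ^ (p - 1)) (W m)
      = s ((Y (m + 1)).1 - (P ^ (p - 1)) (W (m + 1))) := by
    intro m
    have : (P ^ (p - 1)) (s (W (m + 1))) = s ((P ^ (p - 1)) (W (m + 1))) :=
      DFunLike.congr_fun (hPs.pow_left (p - 1)).eq (W (m + 1))
    rw [hW m, hY m, map_add, map_sub, this]
    abel
  have hz : ∀ j m, ((Y m).1 - (P ^ (p - 1)) (W m)) j = 0 := by
    intro j
    induction j with
    | zero => intro m; rw [key, hs, seqShift_apply_zero]
    | succ j ih => intro m; rw [key, hs, seqShift_apply_succ, ih]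
  exact ⟨W 0, (sub_eq_zero.mp (funext fun j => hz j 0)).symm⟩

lemma add_mul_of_commute [Fact p.Prime] [CharP A p] {u v f : A} (huv : Commute u v)
    (huf : Commute u f) (hvf : Commute v f) (hu : u ^ p = 0) (hv : v ^ p = 0)
    (hf : IsNilpotent f) (h : KerLeRangePow p u M) : KerLeRangePow p (u + v * f) M := by
  have hp : p.Prime := Fact.out
  obtain ⟨N, hN⟩ : ∃ N, f ^ (N + 1) = 0 := by
    obtain ⟨N, hN⟩ := hf
    exact ⟨N, by rw [pow_succ, hN, zero_mul]⟩
  intro x hx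
  set s := seqShift M with hs
  set P := seqSMul M u + s * seqSMul M v with hPdef
  have hsv := commute_seqShift_seqSMul (M := M) v
  have hP : P ^ p = 0 := by
    have hcomm : Commute (seqSMul M u) (s * seqSMul M v) :=
      ((commute_seqShift_seqSMul (M := M) u).symm).mul_right (huv.map (seqSMul M))
    obtain ⟨r, hr⟩ := hcomm.exists_add_pow_prime_eq hp
    rw [hr, hsv.mul_pow, ← map_pow, ← map_pow, hu, hv, map_zero, mul_zero, add_zero, zero_add,
      ← map_natCast (seqSMul (A := A) M), CharP.cast_eq_zero, map_zero]
    simp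
  have hex := h.seq hp.ne_zero (seqSMul M v) hsv.symm hP
  have hev : ∀ y, seqEval M f (N + 1) (P y) = (u + v * f) • seqEval M f (N + 1) y := by
    intro y
    change seqEval M f (N + 1) (seqSMul M u y + s (seqSMul M v y)) = _
    rw [map_add, seqEval_seqShift hN, seqEval_seqSMul huf.symm, seqEval_seqSMul hvf.symm,
      smul_smul, hvf.eq, add_smul]
  have hevp : ∀ (j : ℕ) y, seqEval M f (N + 1) ((P ^ j) y) = (u + v * f) ^ j • seqEval M f (N + 1) y := by
    intro j
    induction j with
    | zero => simp
    | succ j ih =>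
      intro y
      rw [pow_succ', pow_succ', mul_smul, ← ih, ← hev]
      rfl
  set F := seqSMul M f with hF
  have hPs : Commute P s := ((commute_seqShift_seqSMul (M := M) u).symm).add_left
    ((Commute.refl s).mul_left hsv.symm)
  have hPF : Commute P F := (huf.map (seqSMul M)).add_left
    ((commute_seqShift_seqSMul f).mul_left (hvf.map (seqSMul M)))
  have hinj : ∀ z : ℕ → M, (s - F) z = 0 → z = 0 := by
    intro z hz
    have hz' : s z = F z := sub_eq_zero.mp hz
    have hstep : ∀ n, z n = f • z (n + 1) := fun n => congrFun hz' (n + 1)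
    have hiter : ∀ j n, z n = f ^ j • z (n + j) := by
      intro j
      induction j with
      | zero => simp
      | succ j ih =>
        intro n
        rw [ih n, hstep (n + j), smul_smul, ← pow_succ, add_assoc]
    ext n
    rw [hiter (N + 1) n, hN, zero_smul, Pi.zero_apply]
  have hPsF : Commute P (s - F) := hPs.sub_right hPF
  set X : ℕ → M := Pi.single 0 x with hX
  have hPX : P X = (s - F) (seqSMul M v X) := by
    ext n
    change u • X n + s (seqSMul M v X) n = s (seqSMul M v X) n - f • (v • X n)
    rw [add_comm, sub_eq_add_neg, add_right_inj, eq_neg_iff_add_eq_zero, smul_smul, ← hvf.eq,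
      ← add_smul]
    cases n with
    | zero => simpa [hX] using hx
    | succ n => simp [hX]
  have hker : (P ^ (p - 1)) (seqSMul M v X) = 0 := by
    apply hinj
    have h1 : (s - F) ((P ^ (p - 1)) (seqSMul M v X)) = (P ^ (p - 1)) (P X) := by
      rw [hPX]
      exact (DFunLike.congr_fun (hPsF.pow_left (p - 1)).eq _).symm
    have h2 : (P ^ (p - 1)) (P X) = (P ^ p) X := by
      rw [← pow_sub_one_mul hp.ne_zero]
      rfl
    rw [h1, h2, hP]
    rfl
  obtain ⟨z, hz⟩ := hex.exists_smul_eq_of_pow_smul_eq_zero (Nat.sub_lt hp.pos one_pos) hker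
  have hz' : P z = seqSMul M v X := by
    rwa [Nat.sub_sub_self hp.one_le, pow_one] at hz
  obtain ⟨w, hw⟩ := hex (X - (s - F) z) (by
    change P (X - (s - F) z) = 0
    rw [map_sub, hPX, ← hz', sub_eq_zero]
    exact (DFunLike.congr_fun hPsF.eq z).symm)
  refine ⟨seqEval M f (N + 1) w, ?_⟩
  rw [← hevp]
  have hw' : (P ^ (p - 1)) w = X - (s - F) z := hw
  have hsF : seqEval M f (N + 1) ((s - F) z) = 0 := by
    change seqEval M f (N + 1) (s z - F z) = 0
    rw [map_sub, seqEval_seqShift hN, seqEval_seqSMul (Commute.refl f), sub_self]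
  rw [hw', map_sub, hsF, sub_zero]
  simp [seqEval, hX, Finset.sum_range_succ']

lemma add_mul_iff [Fact p.Prime] [CharP A p] {u v f : A} (huv : Commute u v)
    (huf : Commute u f) (hvf : Commute v f) (hu : u ^ p = 0) (hv : v ^ p = 0)
    (hf : IsNilpotent f) : KerLeRangePow p u M ↔ KerLeRangePow p (u + v * f) M := by
  refine ⟨add_mul_of_commute huv huf hvf hu hv hf, fun h => ?_⟩
  have hu' : (u + v * f) ^ p = 0 := by
    rw [add_pow_char_of_commute p (huv.mul_right huf), hvf.mul_pow, hu, hv, zero_mul, add_zero]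
  have := h.add_mul_of_commute (v := v) (f := -f) (huv.add_left ((Commute.refl v).mul_left hvf.symm))
    ((huf.add_left (hvf.mul_left (Commute.refl f))).neg_right) hvf.neg_right hu' hv hf.neg
  simpa using this

lemma smul_iff {k : Type*} [Field k] [Algebra k A] {c : k} (hc : c ≠ 0) (u : A) :
    KerLeRangePow p (c • u) M ↔ KerLeRangePow p u M := by
  have aux : ∀ {c : k}, c ≠ 0 → ∀ u : A, KerLeRangePow p u M → KerLeRangePow p (c • u) M := by
    intro c hc u h m hm
    obtain ⟨n, hn⟩ := h m (by
      rw [show u = algebraMap k A c⁻¹ * (c • u) by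
        rw [← Algebra.smul_def, inv_smul_smul₀ hc], mul_smul, hm, smul_zero])
    refine ⟨algebraMap k A (c ^ (p - 1))⁻¹ • n, ?_⟩
    rw [smul_smul, ← Algebra.commutes, ← Algebra.smul_def, smul_pow, smul_smul,
      inv_mul_cancel₀ (pow_ne_zero _ hc), one_smul, hn]
  refine ⟨fun h => ?_, aux hc u⟩
  simpa [smul_smul, hc] using aux (inv_ne_zero hc) _ h

lemma conj_iff (g : Aˣ) (u : A) :
    KerLeRangePow p (g * u * (g⁻¹ : Aˣ)) M ↔ KerLeRangePow p u M := by
  have aux : ∀ (g : Aˣ) (u : A), KerLeRangePow p u M →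
      KerLeRangePow p (g * u * (g⁻¹ : Aˣ)) M := by
    intro g u h m hm
    obtain ⟨n, hn⟩ := h (g⁻¹ • m) (by
      rw [mul_assoc, mul_smul] at hm
      have := congrArg (fun x => g⁻¹ • x) hm
      simpa [Units.smul_def, smul_smul, ← mul_assoc] using this)
    refine ⟨g • n, ?_⟩
    rw [Units.conj_pow, Units.smul_def, smul_smul, mul_assoc, Units.inv_mul, mul_one, mul_smul, hn,
      ← Units.smul_def, smul_inv_smul]
  refine ⟨fun h => ?_, aux g u⟩
  simpa [mul_assoc] using aux g⁻¹ _ h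

end KerLeRangePow

namespace Kt

variable {k : Type} [Field k] {p : ℕ}

/-- The class of `t` in `k[t]/(tᵖ)`. -/
noncomputable def t (k : Type) [Field k] (p : ℕ) : Kt k p :=
  Ideal.Quotient.mk _ Polynomial.X

lemma t_pow : t k p ^ p = 0 := by
  rw [t, ← map_pow, Ideal.Quotient.eq_zero_iff_mem]
  exact Ideal.mem_span_singleton_self _

lemma maximalIdeal_unique [NeZero p] (I : Ideal (Kt k p)) (hI : I.IsMaximal) :
    I = Ideal.span {t k p} := by
  have ht : t k p ∈ I := by
    refine hI.isPrime.mem_of_pow_mem p ?_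
    rw [t_pow]
    exact I.zero_mem
  have hmax : (Ideal.span {t k p}).IsMaximal := by
    have hspan : Ideal.span {t k p} = (Ideal.span {(Polynomial.X : Polynomial k)}).map
        (Ideal.Quotient.mk (Ideal.span {(Polynomial.X : Polynomial k) ^ p})) := by
      rw [Ideal.map_span, Set.image_singleton, t]
    have hX : (Ideal.span {(Polynomial.X : Polynomial k)}).IsMaximal :=
      PrincipalIdealRing.isMaximal_of_irreducible Polynomial.irreducible_X
    rw [hspan]
    refine (Ideal.map_eq_top_or_isMaximal_of_surjective _ Ideal.Quotient.mk_surjective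
      hX).resolve_left fun htop => hI.ne_top ?_
    rw [← hspan] at htop
    exact top_le_iff.mp (htop ▸ (Ideal.span_singleton_le_iff_mem _).mpr ht)
  exact (hmax.eq_of_le hI.ne_top ((Ideal.span_singleton_le_iff_mem _).mpr ht)).symm

lemma nontrivial [NeZero p] : Nontrivial (Kt k p) := by
  refine Ideal.Quotient.nontrivial_iff.mpr ?_
  rw [Ne, Ideal.span_singleton_eq_top]
  exact fun h => Polynomial.not_isUnit_X ((isUnit_pow_iff (NeZero.ne p)).mp h)

lemma isLocalRing [NeZero p] : IsLocalRing (Kt k p) := by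
  have := nontrivial (k := k) (p := p)
  obtain ⟨I, hI⟩ := Ideal.exists_maximal (Kt k p)
  exact IsLocalRing.of_unique_max_ideal
    ⟨I, hI, fun J hJ => (maximalIdeal_unique J hJ).trans (maximalIdeal_unique I hI).symm⟩

lemma kerLeRangePow_self (hp : p ≠ 0) : KerLeRangePow p (t k p) (Kt k p) := by
  intro r hr
  obtain ⟨q, rfl⟩ := Ideal.Quotient.mk_surjective r
  rw [t, smul_eq_mul, ← map_mul, Ideal.Quotient.eq_zero_iff_mem, Ideal.mem_span_singleton] at hr
  obtain ⟨s, hs⟩ := hr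
  rw [← mul_pow_sub_one hp, mul_assoc] at hs
  refine ⟨Ideal.Quotient.mk _ s, ?_⟩
  rw [mul_left_cancel₀ Polynomial.X_ne_zero hs]
  simp [t]

lemma kerLeRangePow_of_projective (hp : p ≠ 0) (M : Type*) [AddCommGroup M] [Module (Kt k p) M]
    [Module.Projective (Kt k p) M] : KerLeRangePow p (t k p) M := by
  obtain ⟨s, hs⟩ := Module.projective_def'.mp ‹Module.Projective (Kt k p) M›
  intro m hm
  have hex : ∀ x : Kt k p, ∃ y : Kt k p, t k p * x = 0 → t k p ^ (p - 1) * y = x := by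
    intro x
    by_cases hx : t k p * x = 0
    · obtain ⟨y, hy⟩ := kerLeRangePow_self hp x hx
      exact ⟨y, fun _ => hy⟩
    · exact ⟨0, fun h => absurd h hx⟩
  choose φ hφ using hex
  have hsm : ∀ x, t k p * s m x = 0 := fun x => by
    rw [← smul_eq_mul, ← Finsupp.smul_apply, ← map_smul, hm, map_zero, Finsupp.zero_apply]
  refine ⟨(s m).sum fun x c => φ c • x, ?_⟩
  have hm' : Finsupp.linearCombination (Kt k p) id (s m) = m := LinearMap.congr_fun hs m
  conv_rhs => rw [← hm', Finsupp.linearCombination_apply]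
  rw [Finsupp.smul_sum]
  refine Finsupp.sum_congr fun x _ => ?_
  rw [smul_smul, hφ _ (hsm x), id]

lemma projective_of_kerLeRangePow [NeZero p] (M : Type*) [AddCommGroup M] [Module (Kt k p) M]
    [Module.Finite (Kt k p) M] (h : KerLeRangePow p (t k p) M) :
    Module.Projective (Kt k p) M := by
  have := isLocalRing (k := k) (p := p)
  have : Module.FinitePresentation (Kt k p) M := Module.finitePresentation_of_finite _ _
  have hmax : IsLocalRing.maximalIdeal (Kt k p) = Ideal.span {t k p} :=
    maximalIdeal_unique _ (IsLocalRing.maximalIdeal.isMaximal _)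
  let τ : IsLocalRing.maximalIdeal (Kt k p) :=
    ⟨t k p, hmax ▸ Ideal.mem_span_singleton_self _⟩
  have hτ : ∀ x : TensorProduct (Kt k p) (IsLocalRing.maximalIdeal (Kt k p)) M,
      ∃ m, x = τ ⊗ₜ[Kt k p] m := by
    intro x
    induction x using TensorProduct.induction_on with
    | zero => exact ⟨0, by simp⟩
    | tmul r m =>
      obtain ⟨r, hr⟩ := r
      obtain ⟨c, rfl⟩ := Ideal.mem_span_singleton'.mp (hmax ▸ hr)
      refine ⟨c • m, ?_⟩
      rw [← TensorProduct.smul_tmul]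
      rfl
    | add x y hx hy =>
      obtain ⟨m, rfl⟩ := hx
      obtain ⟨n, rfl⟩ := hy
      exact ⟨m + n, (TensorProduct.tmul_add _ _ _).symm⟩
  have : Module.Free (Kt k p) M := by
    refine Module.free_of_maximalIdeal_rTensor_injective
      ((injective_iff_map_eq_zero _).mpr fun x hx => ?_)
    obtain ⟨m, rfl⟩ := hτ x
    have hm : t k p • m = 0 := by
      simpa [τ] using congrArg (TensorProduct.lid (Kt k p) M) hx
    obtain ⟨n, rfl⟩ := h m hm
    rw [← TensorProduct.smul_tmul]
    have : t k p ^ (p - 1) • τ = 0 := by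
      ext
      simp [τ, pow_sub_one_mul (NeZero.ne p), t_pow]
    rw [this, TensorProduct.zero_tmul]
  infer_instance

end Kt

section Pullback

variable {k : Type} [Field k] {p : ℕ} {A : Type} [Ring A] [Algebra k A]

lemma pullbackProjective_iff [NeZero p] [Module.Finite k A] (α : Kt k p →ₐ[k] A) (M : Type)
    [AddCommGroup M] [Module A M] [Module.Finite A M] :
    PullbackProjective α M ↔ KerLeRangePow p (α (Kt.t k p)) M := by
  let _ : Module (Kt k p) M := Module.compHom M α.toRingHom
  let _ : Module k M := Module.compHom M (algebraMap k A)
  have hsmul : ∀ (r : Kt k p) (m : M), r • m = α r • m := fun _ _ => rfl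
  have : IsScalarTower k A M := ⟨fun c a m => by
    rw [Algebra.smul_def, mul_smul]; rfl⟩
  have : IsScalarTower k (Kt k p) M := ⟨fun c r m => by
    rw [hsmul, map_smul, smul_assoc]; rfl⟩
  have : Module.Finite k M := Module.Finite.trans A M
  have : Module.Finite (Kt k p) M := Module.Finite.of_restrictScalars_finite k _ _
  have hiff : KerLeRangePow p (Kt.t k p) M ↔ KerLeRangePow p (α (Kt.t k p)) M := by
    simp only [KerLeRangePow, hsmul, map_pow]
  rw [← hiff]
  exact ⟨fun (_ : Module.Projective (Kt k p) M) => Kt.kerLeRangePow_of_projective (NeZero.ne p) M,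
    Kt.projective_of_kerLeRangePow M⟩

end Pullback

/-- If `[u, T] = 1` for some additive operator `T` on `M`, then `u` acts exactly on `M`. -/
lemma KerLeRangePow.of_commutator_eq_one {A : Type*} [Ring A] {p : ℕ} [Fact p.Prime] [CharP A p]
    {M : Type*} [AddCommGroup M] [Module A M] (u : A) (T : M →+ M)
    (hT : ∀ m, u • T m = T (u • m) + m) : KerLeRangePow p u M := by
  have hTj : ∀ (j : ℕ) (m : M), u • m = 0 → u • T^[j + 1] m = (j + 1) • T^[j] m := by
    intro j m hm
    induction j with
    | zero => simp [hT, hm]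
    | succ j ih =>
      rw [Function.iterate_succ_apply', hT, ih, map_nsmul, ← Function.iterate_succ_apply' (⇑T),
        ← succ_nsmul]
  have hfac : ∀ (j : ℕ) (m : M), u • m = 0 → u ^ j • T^[j] m = j.factorial • m := by
    intro j m hm
    induction j with
    | zero => simp
    | succ j ih =>
      rw [pow_succ, mul_smul, hTj j m hm, smul_comm, ih, smul_smul, Nat.factorial_succ]
  have hwilson : ((p - 1).factorial : A) = -1 := by
    rw [← map_natCast (ZMod.castHom dvd_rfl A), ZMod.wilsons_lemma, map_neg, map_one]
  intro m hm
  refine ⟨-T^[p - 1] m, ?_⟩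
  rw [smul_neg, hfac _ m hm, ← Nat.cast_smul_eq_nsmul A, hwilson, neg_smul, one_smul, neg_neg]

section Coinduced

variable {k A M : Type*} [Field k] [Ring A] [Algebra k A] [AddCommGroup M] [Module A M]
  [Module k M] [IsScalarTower k A M]

/-- The part fixed by `e` of the `A`-module coinduced from the restriction of `M` to the subalgebra
generated by `b`. -/
def coinduced (k : Type*) {A : Type*} (M : Type*) [Field k] [Ring A] [Algebra k A] [AddCommGroup M]
    [Module A M] [Module k M] [IsScalarTower k A M] (b e : A) : Submodule k (A →ₗ[k] M) where
  carrier := {f | (∀ x, f (b * x) = b • f x) ∧ ∀ x, f (x * e) = f x}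
  zero_mem' := by simp
  add_mem' := by
    rintro f g ⟨hf, hf'⟩ ⟨hg, hg'⟩
    exact ⟨fun x => by simp [hf, hg], fun x => by simp [hf', hg']⟩
  smul_mem' := by
    rintro c f ⟨hf, hf'⟩
    exact ⟨fun x => by simp [hf, smul_algebra_smul_comm], fun x => by simp [hf']⟩

/-- `A` acts on the coinduced module by right translation of the argument. -/
def coinducedAction (k : Type*) {A : Type*} (M : Type*) [Field k] [Ring A] [Algebra k A]
    [AddCommGroup M] [Module A M] [Module k M] [IsScalarTower k A M] (b : A) {e : A}
    (he : ∀ a, e * a = a * e) : A →+* Module.End k (coinduced k M b e) where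
  toFun a :=
    { toFun := fun f => ⟨f.1 ∘ₗ LinearMap.mulRight k a, fun x => by simp [mul_assoc, f.2.1],
        fun x => by simp [mul_assoc, he, ← f.2.2 (x * a)]⟩
      map_add' := fun _ _ => rfl
      map_smul' := fun _ _ => rfl }
  map_one' := by ext; simp
  map_mul' a a' := by ext; simp [mul_assoc]
  map_zero' := by ext; simp
  map_add' a a' := by ext; simp [mul_add]

end Coinduced

/-- Coinduction of a module `M` fixed by the central idempotent `e` produces a module fixed by `e`
that detects exactness of `b` on `M` and on which `a` is exact as soon as right multiplication by
`a` has a left `b`-linear conjugate variable. -/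
lemma exists_coinduced {k A : Type} [Field k] [Ring A] [Algebra k A] [Module.Finite k A] {p : ℕ}
    [Fact p.Prime] [CharP A p] (b : A) {e : A} (hee : e * e = e) (he : ∀ a, e * a = a * e)
    (M : Type) [AddCommGroup M] [Module A M] [Module.Finite A M] (heM : ∀ m : M, e • m = m) :
    ∃ (N : Type) (_ : AddCommGroup N) (_ : Module A N), Module.Finite A N ∧
      (∀ n : N, e • n = n) ∧
      (∀ (a : A) (D : A →ₗ[k] A), (∀ x, D (b * x) = b * D x) → (∀ x, D (x * a) = D x * a + x) →
        KerLeRangePow p a N) ∧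
      (KerLeRangePow p b N → KerLeRangePow p b M) := by
  let _ : Module k M := Module.compHom M (algebraMap k A)
  have : IsScalarTower k A M := ⟨fun c a m => by rw [Algebra.smul_def, mul_smul]; rfl⟩
  have : Module.Finite k M := Module.Finite.trans A M
  let _ : Module A (coinduced k M b e) := Module.compHom _ (coinducedAction k M b he)
  have hsmul : ∀ (a : A) (f : coinduced k M b e) (x : A), (a • f).1 x = f.1 (x * a) :=
    fun _ _ _ => rfl
  have : IsScalarTower k A (coinduced k M b e) := ⟨fun c a f => by
    ext x
    rw [hsmul, Submodule.coe_smul, LinearMap.smul_apply, hsmul, mul_smul_comm, map_smul]⟩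
  refine ⟨coinduced k M b e, inferInstance, inferInstance,
    Module.Finite.of_restrictScalars_finite k _ _, fun f => ?_, fun a D hDb hDa => ?_,
    fun h m hm => ?_⟩
  · ext x
    rw [hsmul, f.2.2]
  · let T : coinduced k M b e →+ coinduced k M b e :=
      { toFun := fun f => ⟨f.1 ∘ₗ D ∘ₗ LinearMap.mulRight k e,
          fun x => by simp [mul_assoc, hDb, f.2.1], fun x => by simp [mul_assoc, hee]⟩
        map_zero' := rfl
        map_add' := fun _ _ => rfl }
    refine KerLeRangePow.of_commutator_eq_one a T fun f => ?_
    ext x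
    change f.1 (D (x * a * e)) = f.1 (D (x * e) * a) + f.1 x
    rw [mul_assoc, ← he, ← mul_assoc, hDa, map_add, f.2.2]
  · let η : M → coinduced k M b e := fun m =>
      ⟨(LinearMap.toSpanSingleton A M m).restrictScalars k,
        fun x => by simp [mul_smul], fun x => by simp [mul_smul, heM]⟩
    have hη : b • η m = 0 := by
      ext x
      rw [hsmul]
      simp [η, mul_smul, hm]
    obtain ⟨n, hn⟩ := h _ hη
    have hev : ∀ (j : ℕ) (f : coinduced k M b e), (b ^ j • f).1 1 = b ^ j • f.1 1 := by
      intro j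
      induction j with
      | zero => simp
      | succ j ih =>
        intro f
        rw [pow_succ, mul_smul, ih, mul_smul, hsmul, one_mul, ← f.2.1 1, mul_one]
    refine ⟨n.1 1, ?_⟩
    rw [← hev, hn]
    simp [η]

namespace MonoidAlgebra

variable {k G : Type*} [Field k] [Group G]

variable (k) in
/-- The subalgebra of `kG` generated by a subgroup. -/
noncomputable def subgroupAlgebra (S : Subgroup G) : Subalgebra k (MonoidAlgebra k G) :=
  Algebra.adjoin k (of k G '' S)

variable (k) in
/-- The span of the elements `z - 1` for `z ∈ Z`. -/
noncomputable def augSpan (Z : Set G) : Submodule k (MonoidAlgebra k G) :=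
  Submodule.span k ((fun z => of k G z - 1) '' Z)

variable (k) in
/-- The span of the products `(z - 1) (g - 1)` for `z ∈ Z` and `g ∈ S`. -/
noncomputable def augProd (Z S : Set G) : Submodule k (MonoidAlgebra k G) :=
  Submodule.span k (Set.image2 (fun z g => (of k G z - 1) * (of k G g - 1)) Z S)

lemma of_mem_subgroupAlgebra {S : Subgroup G} {g : G} (hg : g ∈ S) :
    of k G g ∈ subgroupAlgebra k S :=
  Algebra.subset_adjoin (Set.mem_image_of_mem _ hg)

lemma mem_subgroupAlgebra_iff {S : Subgroup G} {v : MonoidAlgebra k G} :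
    v ∈ subgroupAlgebra k S ↔ v ∈ Submodule.span k (of k G '' (S : Set G)) := by
  have hcl : (Submonoid.closure (of k G '' (S : Set G)) : Set (MonoidAlgebra k G))
      = of k G '' (S : Set G) := by
    have : of k G '' (S : Set G) = (S.toSubmonoid.map (of k G) : Set (MonoidAlgebra k G)) := rfl
    rw [this, Submonoid.closure_eq]
  rw [subgroupAlgebra, ← Subalgebra.mem_toSubmodule, Algebra.adjoin_eq_span, hcl]

lemma commute_of_mem_subgroupAlgebra {S : Subgroup G} (hS : ∀ x ∈ S, ∀ y ∈ S, x * y = y * x)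
    {u v : MonoidAlgebra k G} (hu : u ∈ subgroupAlgebra k S) (hv : v ∈ subgroupAlgebra k S) :
    Commute u v := by
  refine Algebra.commute_of_mem_adjoin_of_forall_mem_commute hv ?_
  rintro _ ⟨y, hy, rfl⟩
  refine (Algebra.commute_of_mem_adjoin_of_forall_mem_commute hu ?_).symm
  rintro _ ⟨x, hx, rfl⟩
  rw [Commute, SemiconjBy, ← map_mul, ← map_mul, hS x hx y hy]

lemma augSpan_le_subgroupAlgebra {Z : Set G} {S : Subgroup G} (hZ : Z ⊆ S) :
    augSpan k Z ≤ (subgroupAlgebra k S).toSubmodule := by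
  refine Submodule.span_le.mpr ?_
  rintro _ ⟨z, hz, rfl⟩
  exact (subgroupAlgebra k S).sub_mem (of_mem_subgroupAlgebra (hZ hz)) (one_mem _)

lemma augProd_le_subgroupAlgebra {Z : Set G} {S : Subgroup G} (hZ : Z ⊆ S) :
    augProd k Z S ≤ (subgroupAlgebra k S).toSubmodule := by
  refine Submodule.span_le.mpr ?_
  rintro _ ⟨z, hz, g, hg, rfl⟩
  exact (subgroupAlgebra k S).mul_mem (sub_mem (of_mem_subgroupAlgebra (hZ hz)) (one_mem _))
    (sub_mem (of_mem_subgroupAlgebra hg) (one_mem _))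

variable (k G) in
lemma charP_monoidAlgebra (p : ℕ) [CharP k p] : CharP (MonoidAlgebra k G) p :=
  charP_of_injective_algebraMap (algebraMap k (MonoidAlgebra k G)).injective p

variable {p : ℕ} [Fact p.Prime] [CharP k p]

lemma of_sub_one_pow_eq_zero {g : G} {n : ℕ} (hg : g ^ p ^ n = 1) :
    (of k G g - 1) ^ p ^ n = 0 := by
  have := charP_monoidAlgebra k G p
  rw [sub_pow_char_pow_of_commute p n (Commute.one_right _), ← map_pow, hg, map_one, one_pow,
    sub_self]

lemma pow_eq_zero_of_mem_augSpan {S : Subgroup G} (hS : ∀ x ∈ S, ∀ y ∈ S, x * y = y * x)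
    (hp : ∀ x ∈ S, x ^ p = 1) {a : MonoidAlgebra k G} (ha : a ∈ augSpan k (S : Set G)) :
    a ^ p = 0 := by
  have := charP_monoidAlgebra k G p
  induction ha using Submodule.span_induction with
  | mem _ h =>
    obtain ⟨z, hz, rfl⟩ := h
    simpa using of_sub_one_pow_eq_zero (k := k) (n := 1) (by simpa using hp z hz)
  | zero => exact zero_pow (Fact.out : p.Prime).ne_zero
  | add x y hx hy ihx ihy =>
    have hle := augSpan_le_subgroupAlgebra (k := k) (subset_refl (S : Set G))
    rw [add_pow_char_of_commute p (commute_of_mem_subgroupAlgebra hS (hle hx) (hle hy)), ihx, ihy,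
      add_zero]
  | smul c x _ ih => rw [smul_pow, ih, smul_zero]

/-- Adding an element of `augProd k Z S` to `u` does not change exactness. -/
lemma kerLeRangePow_iff_of_sub_mem_augProd {S : Subgroup G} (hS : ∀ x ∈ S, ∀ y ∈ S, x * y = y * x)
    (hSp : IsPGroup p S) {Z : Set G} (hZS : Z ⊆ S) (hZ : ∀ z ∈ Z, z ^ p = 1)
    {M : Type*} [AddCommGroup M] [Module (MonoidAlgebra k G) M] {u w : MonoidAlgebra k G}
    (hu : u ∈ subgroupAlgebra k S) (hup : u ^ p = 0) (huw : w - u ∈ augProd k Z S) :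
    KerLeRangePow p u M ↔ KerLeRangePow p w M := by
  have hchar := charP_monoidAlgebra k G p
  have hcomm : ∀ {x y}, x ∈ subgroupAlgebra k S → y ∈ subgroupAlgebra k S → Commute x y :=
    fun hx hy => commute_of_mem_subgroupAlgebra hS hx hy
  have key : ∀ j ∈ augProd k Z S, j ^ p = 0 ∧ ∀ u ∈ subgroupAlgebra k S, u ^ p = 0 →
      (KerLeRangePow p u M ↔ KerLeRangePow p (u + j) M) := by
    intro j hj
    induction hj using Submodule.closure_induction with
    | zero => simp [(Fact.out : p.Prime).ne_zero]
    | add x y hx hy ihx ihy =>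
      have hxS := augProd_le_subgroupAlgebra (k := k) hZS hx
      have hyS := augProd_le_subgroupAlgebra (k := k) hZS hy
      refine ⟨by rw [add_pow_char_of_commute p (hcomm hxS hyS), ihx.1, ihy.1, add_zero], ?_⟩
      intro u hu hup
      rw [ihx.2 u hu hup, ihy.2 (u + x) (add_mem hu hxS), add_assoc]
      rw [add_pow_char_of_commute p (hcomm hu hxS), ihx.1, hup, add_zero]
    | smul_mem c x hx =>
      obtain ⟨z, hz, g, hg, rfl⟩ := hx
      have hz' : (of k G z - 1) ^ p = 0 := by
        simpa using of_sub_one_pow_eq_zero (k := k) (n := 1) (by simpa using hZ z hz)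
      have hg' : IsNilpotent (c • (of k G g - 1)) := by
        obtain ⟨n, hn⟩ := hSp ⟨g, hg⟩
        refine IsNilpotent.smul ⟨p ^ n, of_sub_one_pow_eq_zero ?_⟩ c
        simpa [Subtype.ext_iff] using hn
      have hzS : of k G z - 1 ∈ subgroupAlgebra k S :=
        sub_mem (of_mem_subgroupAlgebra (hZS hz)) (one_mem _)
      have hgS : c • (of k G g - 1) ∈ subgroupAlgebra k S :=
        Subalgebra.smul_mem _ (sub_mem (of_mem_subgroupAlgebra hg) (one_mem _)) c
      rw [← mul_smul_comm]
      refine ⟨by rw [(hcomm hzS hgS).mul_pow, hz', zero_mul], fun u hu hup => ?_⟩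
      exact KerLeRangePow.add_mul_iff (hcomm hu hzS) (hcomm hu hgS) (hcomm hzS hgS) hup hz' hg'
  simpa using (key _ huw).2 u hu hup

/-- In the group algebra of an abelian group, `u ^ p = 0` forces `u` to lie in the ideal generated
by the elements `z - 1` with `z ^ p = 1`. -/
lemma exists_mem_augSpan_of_pow_eq_zero {S : Subgroup G} (hS : ∀ x ∈ S, ∀ y ∈ S, x * y = y * x)
    {u : MonoidAlgebra k G} (hu : u ∈ subgroupAlgebra k S) (hup : u ^ p = 0) :
    ∃ a ∈ augSpan k {z | z ∈ S ∧ z ^ p = 1}, a - u ∈ augProd k {z | z ∈ S ∧ z ^ p = 1} S := by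
  classical
  have hchar := charP_monoidAlgebra k G p
  set Z : Set G := {z | z ∈ S ∧ z ^ p = 1}
  let Q : MonoidAlgebra k G →ₗ[k] MonoidAlgebra k G :=
    (basis G k).constr k fun g => of k G (g ^ p)
  have hQ : ∀ g, Q (of k G g) = of k G (g ^ p) := fun g => by
    simpa [Q] using (basis G k).constr_basis k (fun g => of k G (g ^ p)) g
  have hpow : ∀ v ∈ subgroupAlgebra k S, v ^ p = map (frobenius k p : k →+ k) (Q v) := by
    intro v hv
    have hv' := mem_subgroupAlgebra_iff.mp hv
    induction hv' using Submodule.span_induction with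
    | mem _ h =>
      obtain ⟨g, -, rfl⟩ := h
      rw [hQ, ← map_pow]
      simp [of_apply]
    | zero => simp [(Fact.out : p.Prime).ne_zero]
    | add x y hx hy ihx ihy =>
      rw [← mem_subgroupAlgebra_iff] at hx hy
      rw [add_pow_char_of_commute p (commute_of_mem_subgroupAlgebra hS hx hy), ihx hx, ihy hy,
        map_add]
      ext g
      simp
    | smul c x hx ih =>
      rw [← mem_subgroupAlgebra_iff] at hx
      rw [smul_pow, ih hx, map_smul]
      ext g
      simp [frobenius_def, mul_pow]
  have hQu : Q u = 0 := by
    have h0 := hpow u hu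
    rw [hup] at h0
    refine map_injective (frobenius k p : k →+ k) (frobenius_inj k p) ?_
    rw [← h0]
    ext; simp
  let σ : G → G := fun h => if hh : ∃ g ∈ S, g ^ p = h then hh.choose else 1
  have hσS : ∀ h, σ h ∈ S := by
    intro h
    by_cases hh : ∃ g ∈ S, g ^ p = h
    · simpa only [σ, dif_pos hh] using hh.choose_spec.1
    · simp only [σ, dif_neg hh, one_mem]
  have hσ : ∀ g ∈ S, σ (g ^ p) ^ p = g ^ p := by
    intro g hg
    have hh : ∃ g' ∈ S, g' ^ p = g ^ p := ⟨g, hg, rfl⟩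
    simpa only [σ, dif_pos hh] using hh.choose_spec.2
  let ρ : MonoidAlgebra k G →ₗ[k] MonoidAlgebra k G :=
    ((basis G k).constr k fun g => of k G (σ g)) ∘ₗ Q
  have hρ : ∀ g, ρ (of k G g) = of k G (σ (g ^ p)) := fun g => by
    rw [LinearMap.comp_apply, hQ]
    simpa using (basis G k).constr_basis k (fun g => of k G (σ g)) (g ^ p)
  have hmem : ∀ v ∈ subgroupAlgebra k S, v - ρ v ∈ augSpan k Z ⊔ augProd k Z S := by
    intro v hv
    rw [mem_subgroupAlgebra_iff] at hv
    induction hv using Submodule.span_induction with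
    | mem _ h =>
      obtain ⟨g, hg, rfl⟩ := h
      set r := σ (g ^ p)
      have hr : r ∈ S := hσS _
      have hz : g * r⁻¹ ∈ Z := by
        refine ⟨mul_mem hg (inv_mem hr), ?_⟩
        rw [(show Commute g r⁻¹ from hS _ hg _ (inv_mem hr)).mul_pow, inv_pow, hσ g hg,
          mul_inv_cancel]
      have hdecomp : of k G g - ρ (of k G g)
          = (of k G (g * r⁻¹) - 1) + (of k G (g * r⁻¹) - 1) * (of k G r - 1) := by
        rw [hρ, mul_sub, sub_mul, ← map_mul, inv_mul_cancel_right]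
        simp [r]
      rw [hdecomp]
      exact Submodule.add_mem_sup (Submodule.subset_span ⟨_, hz, rfl⟩)
        (Submodule.subset_span ⟨_, hz, r, hr, rfl⟩)
    | zero => simp
    | add x y _ _ ihx ihy =>
      rw [map_add, add_sub_add_comm]
      exact add_mem ihx ihy
    | smul c x _ ih =>
      rw [map_smul, ← smul_sub]
      exact Submodule.smul_mem _ c ih
  have hu' := hmem u hu
  rw [show ρ u = 0 by simp [ρ, hQu], sub_zero] at hu'
  obtain ⟨a, ha, j, hj, rfl⟩ := Submodule.mem_sup.mp hu'
  exact ⟨a, ha, by simpa using neg_mem hj⟩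

end MonoidAlgebra

/-- In characteristic `p`, two operators with suitable commutators against `R` and `L` combine to
a single one commuting with `L` and conjugate to `R`. -/
lemma exists_conjugate_of_commutators {Q : Type*} [Ring Q] {p : ℕ} [Fact p.Prime] [CharP Q p]
    {R L D₁ D₂ Φ₁ Φ₂ Ψ₁ Ψ₂ : Q} (h₁R : D₁ * R = R * D₁ + Φ₁) (h₂R : D₂ * R = R * D₂ + Φ₂)
    (h₁L : D₁ * L = L * D₁ + Ψ₁) (h₂L : D₂ * L = L * D₂ + Ψ₂)
    (hRΦ₁ : Commute R Φ₁) (hRΦ₂ : Commute R Φ₂) (hRΨ₁ : Commute R Ψ₁) (hRΨ₂ : Commute R Ψ₂)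
    (hLΦ₁ : Commute L Φ₁) (hLΦ₂ : Commute L Φ₂) (hLΨ₁ : Commute L Ψ₁) (hLΨ₂ : Commute L Ψ₂)
    (hΦ : Commute Φ₁ Φ₂) (hΨ : Commute Ψ₁ Ψ₂) (h₁₁ : Commute Φ₁ Ψ₁) (h₁₂ : Commute Φ₁ Ψ₂)
    (h₂₁ : Commute Φ₂ Ψ₁) (h₂₂ : Commute Φ₂ Ψ₂)
    (hΦ₁ : Φ₁ ^ p = 1) (hΦ₂ : Φ₂ ^ p = 0) (hΨ₂ : Ψ₂ ^ p = 1) :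
    ∃ D, D * R = R * D + 1 ∧ D * L = L * D := by
  set U := Ψ₂ * Φ₁ - Ψ₁ * Φ₂
  have hU : U ^ p = 1 := by
    rw [sub_pow_char_of_commute p, h₁₂.symm.mul_pow, h₂₁.symm.mul_pow, hΦ₁, hΦ₂, hΨ₂]
    · simp
    · exact (hΨ.symm.mul_right h₂₂.symm).mul_left (h₁₁.mul_right hΦ)
  have hUU : U ^ (p - 1) * U = 1 := by
    rw [← pow_succ, Nat.sub_add_cancel (Fact.out : p.Prime).one_le, hU]
  have hRU : Commute R (U ^ (p - 1)) :=
    ((hRΨ₂.mul_right hRΦ₁).sub_right (hRΨ₁.mul_right hRΦ₂)).pow_right _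
  have hLU : Commute L (U ^ (p - 1)) :=
    ((hLΨ₂.mul_right hLΦ₁).sub_right (hLΨ₁.mul_right hLΦ₂)).pow_right _
  refine ⟨U ^ (p - 1) * (Ψ₂ * D₁ - Ψ₁ * D₂), ?_, ?_⟩
  · have : (Ψ₂ * D₁ - Ψ₁ * D₂) * R = R * (Ψ₂ * D₁ - Ψ₁ * D₂) + U := by
      rw [sub_mul, mul_assoc, mul_assoc, h₁R, h₂R, mul_sub, ← mul_assoc R, ← mul_assoc R, hRΨ₁.eq,
        hRΨ₂.eq]
      simp only [U]
      noncomm_ring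
    rw [mul_assoc, this, mul_add, hUU, ← mul_assoc, ← mul_assoc, hRU.eq]
  · have : (Ψ₂ * D₁ - Ψ₁ * D₂) * L = L * (Ψ₂ * D₁ - Ψ₁ * D₂) := by
      rw [sub_mul, mul_assoc, mul_assoc, h₁L, h₂L, mul_sub, ← mul_assoc L, ← mul_assoc L, hLΨ₁.eq,
        hLΨ₂.eq, mul_add, mul_add, hΨ.eq]
      noncomm_ring
    rw [mul_assoc, this, ← mul_assoc, ← mul_assoc, hLU.eq]

namespace MonoidAlgebra

variable {k G : Type*} [Field k] [Group G]

lemma subgroupAlgebra_induction {S : Subgroup G}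
    {P : (v : MonoidAlgebra k G) → v ∈ subgroupAlgebra k S → Prop}
    (of : ∀ x (hx : x ∈ S), P (of k G x) (of_mem_subgroupAlgebra hx)) (zero : P 0 (zero_mem _))
    (add : ∀ v w hv hw, P v hv → P w hw → P (v + w) (add_mem hv hw))
    (smul : ∀ (c : k) v hv, P v hv → P (c • v) (Subalgebra.smul_mem _ hv c))
    {v : MonoidAlgebra k G} (hv : v ∈ subgroupAlgebra k S) : P v hv := by
  have hv' := mem_subgroupAlgebra_iff.mp hv
  induction hv' using Submodule.span_induction with
  | mem _ h => obtain ⟨x, hx, rfl⟩ := h; exact of x hx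
  | zero => exact zero
  | add v w hv' hw' ihv ihw =>
    exact add v w _ _ (ihv (mem_subgroupAlgebra_iff.mpr hv')) (ihw (mem_subgroupAlgebra_iff.mpr hw'))
  | smul c v hv' ih => exact smul c v _ (ih (mem_subgroupAlgebra_iff.mpr hv'))

/-- The operator on `kG` sending a group element `s` to `v s * s * w s`. -/
noncomputable def twoSidedMul (v w : G → MonoidAlgebra k G) :
    Module.End k (MonoidAlgebra k G) :=
  (basis G k).constr k fun s => v s * of k G s * w s

lemma twoSidedMul_of (v w : G → MonoidAlgebra k G) (s : G) :
    twoSidedMul v w (of k G s) = v s * of k G s * w s := by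
  simpa [twoSidedMul] using (basis G k).constr_basis k (fun s => v s * of k G s * w s) s

lemma end_ext {T T' : Module.End k (MonoidAlgebra k G)} (h : ∀ s, T (of k G s) = T' (of k G s)) :
    T = T' :=
  (basis G k).ext fun s => by simpa using h s

lemma twoSidedMul_const (v w x : MonoidAlgebra k G) :
    twoSidedMul (fun _ => v) (fun _ => w) x = v * x * w := by
  have : twoSidedMul (fun _ => v) (fun _ => w) = LinearMap.mulRight k w ∘ₗ LinearMap.mulLeft k v :=
    end_ext fun s => twoSidedMul_of (fun _ => v) (fun _ => w) s
  rw [this]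
  rfl

variable {A E : Subgroup G}

variable (k A) in
/-- A function on `G` that is constant on the double cosets `E s A`, with values in the group
algebra of the subgroup `S`. -/
structure IsDoubleCosetFun (E S : Subgroup G) (v : G → MonoidAlgebra k G) : Prop where
  mem : ∀ s, v s ∈ subgroupAlgebra k S
  invariant : ∀ s, ∀ y ∈ E, ∀ x ∈ A, v (y * s * x) = v s

lemma IsDoubleCosetFun.mul {S : Subgroup G} {v v' : G → MonoidAlgebra k G}
    (hv : IsDoubleCosetFun k A E S v) (hv' : IsDoubleCosetFun k A E S v') :
    IsDoubleCosetFun k A E S (v * v') :=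
  ⟨fun s => mul_mem (hv.mem s) (hv'.mem s), fun s y hy x hx => by
    simp [hv.invariant s y hy x hx, hv'.invariant s y hy x hx]⟩

lemma IsDoubleCosetFun.const {S : Subgroup G} {v : MonoidAlgebra k G}
    (hv : v ∈ subgroupAlgebra k S) : IsDoubleCosetFun k A E S fun _ => v :=
  ⟨fun _ => hv, fun _ _ _ _ _ => rfl⟩

lemma IsDoubleCosetFun.one {S : Subgroup G} : IsDoubleCosetFun k A E S 1 :=
  .const (one_mem _)

lemma IsDoubleCosetFun.pow {S : Subgroup G} {v : G → MonoidAlgebra k G}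
    (hv : IsDoubleCosetFun k A E S v) (n : ℕ) : IsDoubleCosetFun k A E S (v ^ n) := by
  induction n with
  | zero => simpa using IsDoubleCosetFun.one
  | succ n ih => simpa [pow_succ] using ih.mul hv

lemma twoSidedMul_mul_of_mul (hA : ∀ x ∈ A, ∀ y ∈ A, x * y = y * x)
    {v w : G → MonoidAlgebra k G}
    (hv : IsDoubleCosetFun k A E E v) (hw : IsDoubleCosetFun k A E A w) {y x : MonoidAlgebra k G}
    (hy : y ∈ subgroupAlgebra k E) (hx : x ∈ subgroupAlgebra k A) (s : G) :
    twoSidedMul v w (y * of k G s * x) = v s * y * of k G s * (w s * x) := by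
  induction hx using subgroupAlgebra_induction with
  | zero => simp
  | add x x' _ _ hx hx' => simp only [mul_add, map_add, hx, hx']
  | smul c x _ hx => simp only [mul_smul_comm, map_smul, hx]
  | of x hx =>
    induction hy using subgroupAlgebra_induction with
    | zero => simp
    | add y y' _ _ hy hy' => simp only [add_mul, mul_add, map_add, hy, hy']
    | smul c y _ hy => simp only [smul_mul_assoc, mul_smul_comm, map_smul, hy]
    | of y hy =>
      rw [(commute_of_mem_subgroupAlgebra hA (hw.mem s) (of_mem_subgroupAlgebra hx)).eq,
        ← map_mul, ← map_mul, twoSidedMul_of, hv.invariant s y hy x hx, hw.invariant s y hy x hx]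
      simp only [map_mul, mul_assoc]

lemma twoSidedMul_mul (hA : ∀ x ∈ A, ∀ y ∈ A, x * y = y * x) {v w v' w' : G → MonoidAlgebra k G}
    (hv : IsDoubleCosetFun k A E E v) (hw : IsDoubleCosetFun k A E A w)
    (hv' : IsDoubleCosetFun k A E E v') (hw' : IsDoubleCosetFun k A E A w') :
    twoSidedMul v w * twoSidedMul v' w' = twoSidedMul (v * v') (w * w') :=
  end_ext fun s => by
    rw [Module.End.mul_apply, twoSidedMul_of, twoSidedMul_of,
      twoSidedMul_mul_of_mul hA hv hw (hv'.mem s) (hw'.mem s) s]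
    rfl

lemma twoSidedMul_commute (hA : ∀ x ∈ A, ∀ y ∈ A, x * y = y * x)
    (hE : ∀ x ∈ E, ∀ y ∈ E, x * y = y * x) {v w v' w' : G → MonoidAlgebra k G}
    (hv : IsDoubleCosetFun k A E E v) (hw : IsDoubleCosetFun k A E A w)
    (hv' : IsDoubleCosetFun k A E E v') (hw' : IsDoubleCosetFun k A E A w') :
    Commute (twoSidedMul v w) (twoSidedMul v' w') := by
  rw [Commute, SemiconjBy, twoSidedMul_mul hA hv hw hv' hw',
    twoSidedMul_mul hA hv' hw' hv hw]
  congr 1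
  · exact funext fun s => (commute_of_mem_subgroupAlgebra hE (hv.mem s) (hv'.mem s)).eq
  · exact funext fun s => (commute_of_mem_subgroupAlgebra hA (hw.mem s) (hw'.mem s)).eq

lemma twoSidedMul_const_left (b : MonoidAlgebra k G) :
    twoSidedMul (fun _ => b) 1 = LinearMap.mulLeft k b :=
  LinearMap.ext fun x => (twoSidedMul_const b 1 x).trans (mul_one _)

lemma twoSidedMul_const_right (a : MonoidAlgebra k G) :
    twoSidedMul 1 (fun _ => a) = LinearMap.mulRight k a :=
  LinearMap.ext fun x => (twoSidedMul_const 1 a x).trans (by simp)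

lemma twoSidedMul_one : twoSidedMul (1 : G → MonoidAlgebra k G) 1 = 1 :=
  LinearMap.ext fun x => (twoSidedMul_const 1 1 x).trans (by simp)

lemma twoSidedMul_pow (hA : ∀ x ∈ A, ∀ y ∈ A, x * y = y * x) {v w : G → MonoidAlgebra k G}
    (hv : IsDoubleCosetFun k A E E v) (hw : IsDoubleCosetFun k A E A w) (n : ℕ) :
    twoSidedMul v w ^ n = twoSidedMul (v ^ n) (w ^ n) := by
  induction n with
  | zero => simp [twoSidedMul_one]
  | succ n ih => rw [pow_succ, ih, twoSidedMul_mul hA (hv.pow n) (hw.pow n) hv hw, pow_succ,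
      pow_succ]

/-- The operator multiplying each group element `x` by the scalar `φ x`. -/
noncomputable def scale (φ : G → k) : Module.End k (MonoidAlgebra k G) :=
  (basis G k).constr k fun x => φ x • of k G x

lemma scale_of (φ : G → k) (x : G) : scale φ (of k G x) = φ x • of k G x := by
  simpa [scale] using (basis G k).constr_basis k (fun x => φ x • of k G x) x

lemma scale_mem_subgroupAlgebra (φ : G → k) {S : Subgroup G} {v : MonoidAlgebra k G}
    (hv : v ∈ subgroupAlgebra k S) : scale φ v ∈ subgroupAlgebra k S := by
  induction hv using subgroupAlgebra_induction with
  | zero => simp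
  | add v w _ _ hv hw => simpa using add_mem hv hw
  | smul c v _ hv => simpa using Subalgebra.smul_mem _ hv c
  | of x hx =>
    rw [scale_of]
    exact Subalgebra.smul_mem _ (of_mem_subgroupAlgebra hx) _

lemma scale_of_mul {S : Subgroup G} {χ φ : G → k} {s : G}
    (h : ∀ x ∈ S, χ (s * x) = χ s + φ x) {v : MonoidAlgebra k G} (hv : v ∈ subgroupAlgebra k S) :
    scale χ (of k G s * v) = scale χ (of k G s) * v + of k G s * scale φ v := by
  induction hv using subgroupAlgebra_induction with
  | zero => simp
  | add v w _ _ hv hw =>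
    simp only [mul_add, map_add, hv, hw]
    abel
  | smul c v _ hv => simp only [mul_smul_comm, map_smul, hv, smul_add]
  | of x hx =>
    rw [← map_mul, scale_of, scale_of, scale_of, h x hx, add_smul, map_mul, smul_mul_assoc,
      mul_smul_comm]

lemma scale_mul_of {S : Subgroup G} {χ φ : G → k} {s : G}
    (h : ∀ x ∈ S, χ (x * s) = φ x + χ s) {v : MonoidAlgebra k G} (hv : v ∈ subgroupAlgebra k S) :
    scale χ (v * of k G s) = v * scale χ (of k G s) + scale φ v * of k G s := by
  induction hv using subgroupAlgebra_induction with
  | zero => simp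
  | add v w _ _ hv hw =>
    simp only [add_mul, map_add, hv, hw]
    abel
  | smul c v _ hv => simp only [smul_mul_assoc, map_smul, hv, smul_add]
  | of x hx =>
    rw [← map_mul, scale_of, scale_of, scale_of, h x hx, add_smul, map_mul, smul_mul_assoc,
      mul_smul_comm, add_comm]

lemma scale_pow_of_mem_augSpan {p : ℕ} [Fact p.Prime] [CharP k p] {S : Subgroup G}
    (hS : ∀ x ∈ S, ∀ y ∈ S, x * y = y * x) (hp : ∀ x ∈ S, x ^ p = 1)
    (f : Module.Dual k (MonoidAlgebra k G)) {a : MonoidAlgebra k G}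
    (ha : a ∈ augSpan k (S : Set G)) :
    scale (fun x => f (of k G x - 1)) a ^ p = algebraMap k _ (f a ^ p) := by
  have hchar := charP_monoidAlgebra k G p
  have hle := augSpan_le_subgroupAlgebra (k := k) (subset_refl (S : Set G))
  induction ha using Submodule.span_induction with
  | mem _ h =>
    obtain ⟨z, hz, rfl⟩ := h
    have h1 : scale (fun x => f (of k G x - 1)) (1 : MonoidAlgebra k G) = 0 := by
      rw [← map_one (of k G), scale_of, map_one, sub_self, map_zero, zero_smul]
    dsimp only
    rw [map_sub, h1, sub_zero, scale_of, smul_pow, ← map_pow (of k G), hp z hz, map_one,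
      Algebra.algebraMap_eq_smul_one]
  | zero => simp [(Fact.out : p.Prime).ne_zero]
  | add x y hx hy ihx ihy =>
    rw [map_add, add_pow_char_of_commute p (commute_of_mem_subgroupAlgebra hS
      (scale_mem_subgroupAlgebra _ (hle hx)) (scale_mem_subgroupAlgebra _ (hle hy))), ihx, ihy,
      map_add, add_pow_char, map_add]
  | smul c x _ ih => rw [map_smul, smul_pow, ih, map_smul, smul_eq_mul, mul_pow, map_mul,
      Algebra.smul_def, map_pow]

end MonoidAlgebra

namespace MonoidAlgebra

variable {k G : Type*} [Field k] [Group G]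

variable (k) in
/-- A functional on `kG × kG` vanishing on this subspace is a pair of additive characters of `A` and
`E` that are identified by conjugation with `g`. -/
noncomputable def glueSpace (g : G) (A E : Subgroup G) :
    Submodule k (MonoidAlgebra k G × MonoidAlgebra k G) :=
  (augProd k A A).prod (augProd k E E) ⊔
    (augSpan k {x | x ∈ A ∧ g * x * g⁻¹ ∈ E}).map
      (LinearMap.id.prod (-(LinearMap.mulLeft k (of k G g) ∘ₗ LinearMap.mulRight k (of k G g⁻¹))))

section Characters

variable {g : G} {A E : Subgroup G} {F : Module.Dual k (MonoidAlgebra k G × MonoidAlgebra k G)}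

lemma of_mul_sub_one (x y : G) :
    of k G (x * y) - 1 = (of k G x - 1) + (of k G y - 1) + (of k G x - 1) * (of k G y - 1) := by
  rw [map_mul]
  noncomm_ring

lemma glueSpace_left_mul (hF : F ∈ (glueSpace k g A E).dualAnnihilator) {x y : G} (hx : x ∈ A)
    (hy : y ∈ A) :
    F (of k G (x * y) - 1, 0) = F (of k G x - 1, 0) + F (of k G y - 1, 0) := by
  have h : F ((of k G x - 1) * (of k G y - 1), 0) = 0 :=
    (Submodule.mem_dualAnnihilator _).mp hF _ (Submodule.mem_sup_left
      ⟨Submodule.subset_span ⟨x, hx, y, hy, rfl⟩, zero_mem _⟩)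
  rw [of_mul_sub_one, ← add_zero (F _ + F _), ← h, ← map_add, ← map_add]
  simp only [Prod.mk_add_mk, add_zero]

lemma glueSpace_right_mul (hF : F ∈ (glueSpace k g A E).dualAnnihilator) {x y : G} (hx : x ∈ E)
    (hy : y ∈ E) :
    F (0, of k G (x * y) - 1) = F (0, of k G x - 1) + F (0, of k G y - 1) := by
  have h : F (0, (of k G x - 1) * (of k G y - 1)) = 0 :=
    (Submodule.mem_dualAnnihilator _).mp hF _ (Submodule.mem_sup_left
      ⟨zero_mem _, Submodule.subset_span ⟨x, hx, y, hy, rfl⟩⟩)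
  rw [of_mul_sub_one, ← add_zero (F _ + F _), ← h, ← map_add, ← map_add]
  simp only [Prod.mk_add_mk, add_zero]

lemma glueSpace_conj (hF : F ∈ (glueSpace k g A E).dualAnnihilator) {x : G} (hx : x ∈ A)
    (hgx : g * x * g⁻¹ ∈ E) :
    F (of k G x - 1, 0) = F (0, of k G (g * x * g⁻¹) - 1) := by
  have h := (Submodule.mem_dualAnnihilator _).mp hF _ (Submodule.mem_sup_right
    (Submodule.mem_map_of_mem (Submodule.subset_span ⟨x, ⟨hx, hgx⟩, rfl⟩)))
  rw [← sub_eq_zero, ← map_sub, ← h]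
  congr 1
  ext1
  · simp
  · simp [-of_apply, sub_mul, mul_sub, ← map_mul, mul_assoc]

lemma glueSpace_welldefined (hF : F ∈ (glueSpace k g A E).dualAnnihilator) {x x' y y' : G}
    (hx : x ∈ A) (hx' : x' ∈ A) (hy : y ∈ E) (hy' : y' ∈ E) (h : y * g * x = y' * g * x') :
    F (0, of k G y - 1) + F (of k G x - 1, 0) = F (0, of k G y' - 1) + F (of k G x' - 1, 0) := by
  have hconj : g * (x' * x⁻¹) * g⁻¹ = y'⁻¹ * y := by
    rw [eq_inv_mul_iff_mul_eq, ← mul_assoc, ← mul_assoc, ← mul_assoc, ← h]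
    group
  have h₁ := glueSpace_conj hF (mul_mem hx' (inv_mem hx))
    (by rw [hconj]; exact mul_mem (inv_mem hy') hy)
  have h₂ := glueSpace_left_mul hF (mul_mem hx' (inv_mem hx)) hx
  have h₃ := glueSpace_right_mul hF hy' (mul_mem (inv_mem hy') hy)
  rw [inv_mul_cancel_right] at h₂
  rw [mul_inv_cancel_left] at h₃
  rw [hconj] at h₁
  rw [h₂, h₃, h₁]
  ring

end Characters

/-- Representatives of the double cosets `E s A`. -/
lemma exists_doubleCoset_rep (A E : Subgroup G) :
    ∃ r : G → G, (∀ s, ∀ y ∈ E, ∀ x ∈ A, r (y * s * x) = r s) ∧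
      ∀ s, ∃ y ∈ E, ∃ x ∈ A, s = y * r s * x := by
  refine ⟨fun s => (DoubleCoset.mk E A s).out, fun s y hy x hx => ?_, fun s => ?_⟩
  · dsimp only
    rw [(DoubleCoset.eq E A s (y * s * x)).mpr ⟨y, hy, x, hx, rfl⟩]
  · exact (DoubleCoset.eq E A _ s).mp (DoubleCoset.out_eq' E A _)

/-- Characters glued over all double cosets define a function on `G`. -/
lemma exists_glued_function {A E : Subgroup G} {r : G → G}
    (hr : ∀ s, ∀ y ∈ E, ∀ x ∈ A, r (y * s * x) = r s)
    (hr' : ∀ s, ∃ y ∈ E, ∃ x ∈ A, s = y * r s * x)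
    {F : G → Module.Dual k (MonoidAlgebra k G × MonoidAlgebra k G)}
    (hF : ∀ g, F g ∈ (glueSpace k g A E).dualAnnihilator) :
    ∃ χ : G → k, (∀ s, ∀ x ∈ A, χ (s * x) = χ s + F (r s) (of k G x - 1, 0)) ∧
      ∀ s, ∀ y ∈ E, χ (y * s) = F (r s) (0, of k G y - 1) + χ s := by
  choose y hy x hx hs using hr'
  refine ⟨fun s => F (r s) (0, of k G (y s) - 1) + F (r s) (of k G (x s) - 1, 0),
    fun s x' hx' => ?_, fun s y' hy' => ?_⟩
  · have hrs : r (s * x') = r s := by simpa using hr s 1 (one_mem _) x' hx'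
    dsimp only
    rw [hrs, add_assoc, ← glueSpace_left_mul (hF _) (hx s) hx']
    refine glueSpace_welldefined (hF _) (hx _) (mul_mem (hx _) hx') (hy _) (hy _) ?_
    rw [← mul_assoc, ← hs s, ← hrs, ← hs]
  · have hrs : r (y' * s) = r s := by simpa using hr s y' hy' 1 (one_mem _)
    dsimp only
    rw [hrs, ← add_assoc, ← glueSpace_right_mul (hF _) hy' (hy s)]
    refine glueSpace_welldefined (hF _) (hx _) (hx _) (hy _) (mul_mem hy' (hy _)) ?_
    rw [mul_assoc y', mul_assoc y', ← hs s, ← hrs, ← hs]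

/-- The operator attached to characters glued over all double cosets, and its commutators. -/
lemma exists_commutators {p : ℕ} [Fact p.Prime] [CharP k p] {A E : Subgroup G}
    (hA : ∀ x ∈ A, ∀ y ∈ A, x * y = y * x) (hAp : ∀ x ∈ A, x ^ p = 1)
    (hE : ∀ x ∈ E, ∀ y ∈ E, x * y = y * x) (hEp : ∀ x ∈ E, x ^ p = 1) {r : G → G}
    (hr : ∀ s, ∀ y ∈ E, ∀ x ∈ A, r (y * s * x) = r s)
    (hr' : ∀ s, ∃ y ∈ E, ∃ x ∈ A, s = y * r s * x) {a b : MonoidAlgebra k G}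
    (ha : a ∈ augSpan k (A : Set G)) (hb : b ∈ augSpan k (E : Set G)) {c d : k}
    (hF : ∀ g, ∃ F ∈ (glueSpace k g A E).dualAnnihilator, F (a, 0) = c ∧ F (0, b) = d) :
    ∃ (D : Module.End k (MonoidAlgebra k G)) (v w : G → MonoidAlgebra k G),
      IsDoubleCosetFun k A E E v ∧ IsDoubleCosetFun k A E A w ∧
      D * twoSidedMul 1 (fun _ => a) = twoSidedMul 1 (fun _ => a) * D + twoSidedMul 1 w ∧
      D * twoSidedMul (fun _ => b) 1 = twoSidedMul (fun _ => b) 1 * D + twoSidedMul v 1 ∧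
      (∀ s, w s ^ p = algebraMap k _ (c ^ p)) ∧ ∀ s, v s ^ p = algebraMap k _ (d ^ p) := by
  choose F hF hFa hFb using hF
  obtain ⟨χ, hχ, hχ'⟩ := exists_glued_function hr hr' hF
  have haA := augSpan_le_subgroupAlgebra (k := k) (subset_refl (A : Set G)) ha
  have hbE := augSpan_le_subgroupAlgebra (k := k) (subset_refl (E : Set G)) hb
  refine ⟨scale χ, fun s => scale (fun y => F (r s) (0, of k G y - 1)) b,
    fun s => scale (fun x => F (r s) (of k G x - 1, 0)) a,
    ⟨fun s => scale_mem_subgroupAlgebra _ hbE, fun s y hy x hx => by rw [hr s y hy x hx]⟩,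
    ⟨fun s => scale_mem_subgroupAlgebra _ haA, fun s y hy x hx => by rw [hr s y hy x hx]⟩,
    end_ext fun s => ?_, end_ext fun s => ?_, fun s => ?_, fun s => ?_⟩
  · rw [twoSidedMul_const_right, LinearMap.add_apply, Module.End.mul_apply, Module.End.mul_apply,
      LinearMap.mulRight_apply, LinearMap.mulRight_apply, scale_of_mul (hχ s) haA, twoSidedMul_of,
      Pi.one_apply, one_mul]
  · rw [twoSidedMul_const_left, LinearMap.add_apply, Module.End.mul_apply, Module.End.mul_apply,
      LinearMap.mulLeft_apply, LinearMap.mulLeft_apply, scale_mul_of (hχ' s) hbE, twoSidedMul_of,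
      Pi.one_apply, mul_one]
  · have := scale_pow_of_mem_augSpan hA hAp (F (r s) ∘ₗ LinearMap.inl k _ _) ha
    simpa [hFa] using this
  · have := scale_pow_of_mem_augSpan hE hEp (F (r s) ∘ₗ LinearMap.inr k _ _) hb
    simpa [hFb] using this

/-- If glued characters separate `a` and `b`, there is a left `b`-linear operator on `kG` conjugate
to right multiplication by `a`. -/
lemma exists_conjugate_operator {p : ℕ} [Fact p.Prime] [CharP k p] {A E : Subgroup G}
    (hA : ∀ x ∈ A, ∀ y ∈ A, x * y = y * x) (hAp : ∀ x ∈ A, x ^ p = 1)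
    (hE : ∀ x ∈ E, ∀ y ∈ E, x * y = y * x) (hEp : ∀ x ∈ E, x ^ p = 1) {a b : MonoidAlgebra k G}
    (ha : a ∈ augSpan k (A : Set G)) (hb : b ∈ augSpan k (E : Set G))
    (hF₁ : ∀ g, ∃ F ∈ (glueSpace k g A E).dualAnnihilator, F (a, 0) = 1 ∧ F (0, b) = 0)
    (hF₂ : ∀ g, ∃ F ∈ (glueSpace k g A E).dualAnnihilator, F (a, 0) = 0 ∧ F (0, b) = 1) :
    ∃ D : MonoidAlgebra k G →ₗ[k] MonoidAlgebra k G,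
      (∀ x, D (b * x) = b * D x) ∧ ∀ x, D (x * a) = D x * a + x := by
  have hp0 := (Fact.out : p.Prime).ne_zero
  have : CharP (Module.End k (MonoidAlgebra k G)) p :=
    charP_of_injective_algebraMap (algebraMap k _).injective p
  obtain ⟨r, hr, hr'⟩ := exists_doubleCoset_rep A E
  obtain ⟨D₁, v₁, w₁, hv₁, hw₁, hDa₁, hDb₁, hwp₁, -⟩ :=
    exists_commutators hA hAp hE hEp hr hr' ha hb hF₁
  obtain ⟨D₂, v₂, w₂, hv₂, hw₂, hDa₂, hDb₂, hwp₂, hvp₂⟩ :=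
    exists_commutators hA hAp hE hEp hr hr' ha hb hF₂
  have hca : IsDoubleCosetFun k A E A fun _ => a :=
    .const (augSpan_le_subgroupAlgebra (subset_refl (A : Set G)) ha)
  have hcb : IsDoubleCosetFun k A E E fun _ => b :=
    .const (augSpan_le_subgroupAlgebra (subset_refl (E : Set G)) hb)
  have hone : ∀ S, IsDoubleCosetFun k A E S 1 := fun _ => .one
  have hcomm := @twoSidedMul_commute k G _ _ A E hA hE
  obtain ⟨D, hDa, hDb⟩ := exists_conjugate_of_commutators (p := p) hDa₁ hDa₂ hDb₁ hDb₂
    (hcomm (hone _) hca (hone _) hw₁) (hcomm (hone _) hca (hone _) hw₂)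
    (hcomm (hone _) hca hv₁ (hone _)) (hcomm (hone _) hca hv₂ (hone _))
    (hcomm hcb (hone _) (hone _) hw₁) (hcomm hcb (hone _) (hone _) hw₂)
    (hcomm hcb (hone _) hv₁ (hone _)) (hcomm hcb (hone _) hv₂ (hone _))
    (hcomm (hone _) hw₁ (hone _) hw₂) (hcomm hv₁ (hone _) hv₂ (hone _))
    (hcomm (hone _) hw₁ hv₁ (hone _)) (hcomm (hone _) hw₁ hv₂ (hone _))
    (hcomm (hone _) hw₂ hv₁ (hone _)) (hcomm (hone _) hw₂ hv₂ (hone _))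
    (by
      rw [twoSidedMul_pow hA (hone _) hw₁, one_pow, show w₁ ^ p = 1 from funext fun s => by
        rw [Pi.pow_apply, hwp₁ s, one_pow, map_one, Pi.one_apply], twoSidedMul_one])
    (by
      rw [twoSidedMul_pow hA (hone _) hw₂, show w₂ ^ p = 0 from funext fun s => by
        simp [hwp₂ s, hp0]]
      exact LinearMap.ext fun x => (twoSidedMul_const (1 ^ p) 0 x).trans (by simp))
    (by
      rw [twoSidedMul_pow hA hv₂ (hone _), one_pow, show v₂ ^ p = 1 from funext fun s => by
        rw [Pi.pow_apply, hvp₂ s, one_pow, map_one, Pi.one_apply], twoSidedMul_one])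
  rw [twoSidedMul_const_right] at hDa
  rw [twoSidedMul_const_left] at hDb
  exact ⟨D, LinearMap.congr_fun hDb, LinearMap.congr_fun hDa⟩

/-- If glued characters at `g` fail to separate `a` and `b`, then multiples of `a` and `b` agree,
up to conjugation by `g`, modulo products of augmentation elements. -/
lemma exists_smul_of_not_separated {A E : Subgroup G} {g : G} {a b : MonoidAlgebra k G}
    (h : ¬ ((∃ F ∈ (glueSpace k g A E).dualAnnihilator, F (a, 0) = 1 ∧ F (0, b) = 0) ∧
      ∃ F ∈ (glueSpace k g A E).dualAnnihilator, F (a, 0) = 0 ∧ F (0, b) = 1)) :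
    ∃ c d : k, (c ≠ 0 ∨ d ≠ 0) ∧ ∃ h ∈ augSpan k {x | x ∈ A ∧ g * x * g⁻¹ ∈ E},
      c • a - h ∈ augProd k (A : Set G) A ∧
      d • b + of k G g * h * of k G g⁻¹ ∈ augProd k (E : Set G) E := by
  let ev : Module.Dual k (MonoidAlgebra k G × MonoidAlgebra k G) →ₗ[k] k × k :=
    (Module.Dual.eval k _ (a, 0)).prod (Module.Dual.eval k _ (0, b))
  have hev : ∃ v : k × k, v ∉ (glueSpace k g A E).dualAnnihilator.map ev := by
    by_contra! hall
    obtain ⟨F, hF, hFe⟩ := hall (1, 0)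
    obtain ⟨F', hF', hFe'⟩ := hall (0, 1)
    rw [Prod.ext_iff] at hFe hFe'
    exact h ⟨⟨F, hF, hFe⟩, ⟨F', hF', hFe'⟩⟩
  obtain ⟨v, hv⟩ := hev
  obtain ⟨l, hlv, hl⟩ := Submodule.exists_le_ker_of_notMem hv
  have hlval : ∀ x y : k, l (x, y) = x * l (1, 0) + y * l (0, 1) := fun x y => by
    rw [← smul_eq_mul, ← smul_eq_mul, ← map_smul, ← map_smul, ← map_add]
    simp
  refine ⟨l (1, 0), l (0, 1), ?_, ?_⟩
  · by_contra! hcd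
    exact hlv (by rw [← Prod.mk.eta (p := v), hlval, hcd.1, hcd.2]; simp)
  have hmem : (l (1, 0) • a, l (0, 1) • b) ∈ glueSpace k g A E := by
    refine (Subspace.forall_mem_dualAnnihilator_apply_eq_zero_iff _ _).mp fun F hF => ?_
    have h0 : l (F (a, 0), F (0, b)) = 0 := hl (Submodule.mem_map_of_mem hF)
    rw [hlval] at h0
    refine Eq.trans ?_ h0
    rw [mul_comm, mul_comm (F (0, b)), ← smul_eq_mul, ← smul_eq_mul, ← map_smul,
      ← map_smul, ← map_add]
    simp only [Prod.smul_mk, smul_zero, Prod.mk_add_mk, add_zero, zero_add]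
  obtain ⟨⟨j, j'⟩, ⟨hj, hj'⟩, _, ⟨h, hh, rfl⟩, hsum⟩ := Submodule.mem_sup.mp hmem
  obtain ⟨hsum₁, hsum₂⟩ := Prod.ext_iff.mp hsum
  dsimp only at hsum₁ hsum₂
  refine ⟨h, hh, ?_, ?_⟩
  · rw [← hsum₁]
    simpa using hj
  · rw [← hsum₂]
    simpa [-of_apply, mul_assoc] using hj'

end MonoidAlgebra

namespace MonoidAlgebra

variable {k G : Type*} [Field k] [Group G] {p : ℕ} [Fact p.Prime]

lemma not_kerLeRangePow_zero : ¬ KerLeRangePow p (0 : MonoidAlgebra k G) (MonoidAlgebra k G) := by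
  intro h
  obtain ⟨n, hn⟩ := h 1 (zero_smul _ _)
  rw [zero_pow (Nat.sub_ne_zero_of_lt (Fact.out : p.Prime).one_lt), zero_smul] at hn
  exact zero_ne_one hn

lemma conj_mem_augSpan {A E : Subgroup G} {g : G} {h : MonoidAlgebra k G}
    (hh : h ∈ augSpan k {x | x ∈ A ∧ g * x * g⁻¹ ∈ E}) :
    of k G g * h * of k G g⁻¹ ∈ augSpan k (E : Set G) := by
  induction hh using Submodule.span_induction with
  | mem _ hx =>
    obtain ⟨x, ⟨-, hx⟩, rfl⟩ := hx
    refine Submodule.subset_span ⟨_, hx, ?_⟩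
    simp only [mul_sub, sub_mul, ← map_mul, mul_one, mul_inv_cancel, map_one]
  | zero => simp
  | add v w _ _ hv hw =>
    rw [mul_add, add_mul]
    exact add_mem hv hw
  | smul c v _ hv =>
    rw [mul_smul_comm, smul_mul_assoc]
    exact Submodule.smul_mem _ c hv

variable [CharP k p] {A E : Subgroup G} {g : G} {a b h : MonoidAlgebra k G} {c d : k}

/-- Elements that agree up to conjugation and products of augmentation elements are exact on the
same modules. -/
lemma kerLeRangePow_iff_of_add_conj_mem_augProd (hA : ∀ x ∈ A, ∀ y ∈ A, x * y = y * x)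
    (hAp : ∀ x ∈ A, x ^ p = 1) (hE : ∀ x ∈ E, ∀ y ∈ E, x * y = y * x) (hEp : ∀ x ∈ E, x ^ p = 1)
    (hh : h ∈ augSpan k {x | x ∈ A ∧ g * x * g⁻¹ ∈ E})
    (hah : a - h ∈ augProd k (A : Set G) A)
    (hbh : b + of k G g * h * of k G g⁻¹ ∈ augProd k (E : Set G) E)
    (M : Type*) [AddCommGroup M] [Module (MonoidAlgebra k G) M] :
    KerLeRangePow p a M ↔ KerLeRangePow p b M := by
  have hpgroup : ∀ {S : Subgroup G}, (∀ x ∈ S, x ^ p = 1) → IsPGroup p S := fun hS x =>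
    ⟨1, by simpa [Subtype.ext_iff] using hS x x.2⟩
  have hhA : h ∈ augSpan k (A : Set G) :=
    Submodule.span_mono (Set.image_mono fun _ hx => hx.1) hh
  have hhE := neg_mem (conj_mem_augSpan hh)
  have h₁ : KerLeRangePow p h M ↔ KerLeRangePow p a M :=
    kerLeRangePow_iff_of_sub_mem_augProd hA (hpgroup hAp) subset_rfl hAp
      (augSpan_le_subgroupAlgebra subset_rfl hhA) (pow_eq_zero_of_mem_augSpan hA hAp hhA) hah
  have h₂ : KerLeRangePow p (-(of k G g * h * of k G g⁻¹)) M ↔ KerLeRangePow p b M :=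
    kerLeRangePow_iff_of_sub_mem_augProd hE (hpgroup hEp) subset_rfl hEp
      (augSpan_le_subgroupAlgebra subset_rfl hhE) (pow_eq_zero_of_mem_augSpan hE hEp hhE)
      (by rwa [sub_neg_eq_add])
  have h₃ : KerLeRangePow p (of k G g * h * of k G g⁻¹) M ↔ KerLeRangePow p h M :=
    KerLeRangePow.conj_iff (Units.map (of k G) (toUnits g)) h
  rw [← h₁, ← h₂, ← neg_one_smul k, KerLeRangePow.smul_iff (neg_ne_zero.mpr one_ne_zero), h₃]

/-- Elements that agree up to scalars, conjugation and products of augmentation elements are exact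
on the same modules. -/
lemma kerLeRangePow_iff_of_smul_add_conj_mem_augProd (hA : ∀ x ∈ A, ∀ y ∈ A, x * y = y * x)
    (hAp : ∀ x ∈ A, x ^ p = 1) (hE : ∀ x ∈ E, ∀ y ∈ E, x * y = y * x) (hEp : ∀ x ∈ E, x ^ p = 1)
    (hcd : c ≠ 0 ∨ d ≠ 0) (hh : h ∈ augSpan k {x | x ∈ A ∧ g * x * g⁻¹ ∈ E})
    (hah : c • a - h ∈ augProd k (A : Set G) A)
    (hbh : d • b + of k G g * h * of k G g⁻¹ ∈ augProd k (E : Set G) E)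
    (ha : KerLeRangePow p a (MonoidAlgebra k G)) (hb : KerLeRangePow p b (MonoidAlgebra k G))
    (M : Type*) [AddCommGroup M] [Module (MonoidAlgebra k G) M] :
    KerLeRangePow p a M ↔ KerLeRangePow p b M := by
  have key := kerLeRangePow_iff_of_add_conj_mem_augProd hA hAp hE hEp hh hah hbh
    (MonoidAlgebra k G)
  have hc : c ≠ 0 := by
    rintro rfl
    refine not_kerLeRangePow_zero (k := k) (G := G) (p := p) ?_
    rw [← zero_smul k a, key]
    exact (KerLeRangePow.smul_iff (hcd.resolve_left (not_not.mpr rfl)) b).mpr hb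
  have hd : d ≠ 0 := by
    rintro rfl
    refine not_kerLeRangePow_zero (k := k) (G := G) (p := p) ?_
    rw [← zero_smul k b, ← key]
    exact (KerLeRangePow.smul_iff hc a).mpr ha
  rw [← KerLeRangePow.smul_iff hc, ← KerLeRangePow.smul_iff hd b]
  exact kerLeRangePow_iff_of_add_conj_mem_augProd hA hAp hE hEp hh hah hbh M

end MonoidAlgebra

/-- A `p`-point can be replaced by an element in the span of the augmentation elements of an
elementary abelian subgroup. -/
lemma IsPPoint.exists_mem_augSpan {k G : Type} [Field k] [Group G] [Finite G] {p : ℕ}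
    [Fact p.Prime] [CharP k p] {α : Kt k p →ₐ[k] MonoidAlgebra k G} (hα : IsPPoint α) :
    ∃ (A : Subgroup G) (a : MonoidAlgebra k G), (∀ x ∈ A, ∀ y ∈ A, x * y = y * x) ∧
      (∀ x ∈ A, x ^ p = 1) ∧ a ∈ MonoidAlgebra.augSpan k (A : Set G) ∧
      KerLeRangePow p a (MonoidAlgebra k G) ∧
      ∀ (M : Type) [AddCommGroup M] [Module (MonoidAlgebra k G) M],
        Module.Finite (MonoidAlgebra k G) M → (PullbackProjective α M ↔ KerLeRangePow p a M) := by
  have : NeZero p := ⟨(Fact.out : p.Prime).ne_zero⟩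
  have : Module.Finite k (MonoidAlgebra k G) := Module.Finite.of_basis (MonoidAlgebra.basis G k)
  obtain ⟨hflat, S, hSp, hS, hmem⟩ := hα
  have hS' : ∀ x ∈ S, ∀ y ∈ S, x * y = y * x := fun x hx y hy =>
    congrArg Subtype.val (hS ⟨x, hx⟩ ⟨y, hy⟩)
  have hu : α (Kt.t k p) ∈ MonoidAlgebra.subgroupAlgebra k S :=
    MonoidAlgebra.mem_subgroupAlgebra_iff.mpr (hmem _)
  have hup : α (Kt.t k p) ^ p = 0 := by rw [← map_pow, Kt.t_pow, map_zero]
  obtain ⟨a, ha, hau⟩ := MonoidAlgebra.exists_mem_augSpan_of_pow_eq_zero hS' hu hup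
  let A : Subgroup G :=
    { carrier := {z | z ∈ S ∧ z ^ p = 1}
      one_mem' := ⟨one_mem _, one_pow _⟩
      mul_mem' := fun {x y} hx hy => ⟨mul_mem hx.1 hy.1, by
        rw [(show Commute x y from hS' _ hx.1 _ hy.1).mul_pow, hx.2, hy.2, one_mul]⟩
      inv_mem' := fun {x} hx => ⟨inv_mem hx.1, by rw [inv_pow, hx.2, inv_one]⟩ }
  have hiff (M : Type) [AddCommGroup M] [Module (MonoidAlgebra k G) M]
      (_ : Module.Finite (MonoidAlgebra k G) M) :
      PullbackProjective α M ↔ KerLeRangePow p a M := by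
    rw [pullbackProjective_iff, MonoidAlgebra.kerLeRangePow_iff_of_sub_mem_augProd hS' hSp
      (fun _ hz => hz.1) (fun _ hz => hz.2) hu hup hau]
  exact ⟨A, a, fun x hx y hy => hS' x hx.1 y hy.1, fun x hx => hx.2, ha,
    (hiff _ inferInstance).mp hflat, hiff⟩

/-- Let `B = kGe` be a block of `kG` and `α, β` two `p`-points of `G` whose supports meet
the block (there are finitely generated modules `M₁, M₂` lying in `B` with `α*(M₁)`,
`β*(M₂)` non-projective).  If `α` and `β` agree (in the sense of projectivity of pullbacks)
on all finitely generated modules lying in `B`, then they agree on all finitely generated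
`kG`-modules. -/
theorem stmt8 (k : Type) [Field k] [IsAlgClosed k] (p : ℕ) [Fact p.Prime] [CharP k p]
    (G : Type) [Group G] [Fintype G]
    (e : MonoidAlgebra k G) (he : IsPrimitiveCentralIdempotent e)
    (α β : Kt k p →ₐ[k] MonoidAlgebra k G) (hα : IsPPoint α) (hβ : IsPPoint β)
    (hM₁ : ∃ (M₁ : Type) (_ : AddCommGroup M₁) (_ : Module (MonoidAlgebra k G) M₁),
      Module.Finite (MonoidAlgebra k G) M₁ ∧ (∀ m : M₁, e • m = m) ∧
        ¬ PullbackProjective α M₁)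
    (hM₂ : ∃ (M₂ : Type) (_ : AddCommGroup M₂) (_ : Module (MonoidAlgebra k G) M₂),
      Module.Finite (MonoidAlgebra k G) M₂ ∧ (∀ m : M₂, e • m = m) ∧
        ¬ PullbackProjective β M₂)
    (hblock : ∀ (N : Type) [AddCommGroup N] [Module (MonoidAlgebra k G) N],
      Module.Finite (MonoidAlgebra k G) N → (∀ n : N, e • n = n) →
        (PullbackProjective α N ↔ PullbackProjective β N)) :
    ∀ (N : Type) [AddCommGroup N] [Module (MonoidAlgebra k G) N],
      Module.Finite (MonoidAlgebra k G) N →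
        (PullbackProjective α N ↔ PullbackProjective β N) := by
  have := MonoidAlgebra.charP_monoidAlgebra k G p
  have : Module.Finite k (MonoidAlgebra k G) := Module.Finite.of_basis (MonoidAlgebra.basis G k)
  obtain ⟨A, a, hA, hAp, ha, haG, hαa⟩ := hα.exists_mem_augSpan
  obtain ⟨E, b, hE, hEp, hb, hbG, hβb⟩ := hβ.exists_mem_augSpan
  by_cases hsep : ∀ g, (∃ F ∈ (MonoidAlgebra.glueSpace k g A E).dualAnnihilator,
      F (a, 0) = 1 ∧ F (0, b) = 0) ∧
      ∃ F ∈ (MonoidAlgebra.glueSpace k g A E).dualAnnihilator, F (a, 0) = 0 ∧ F (0, b) = 1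
  · exfalso
    obtain ⟨D, hDb, hDa⟩ := MonoidAlgebra.exists_conjugate_operator hA hAp hE hEp ha hb
      (fun g => (hsep g).1) (fun g => (hsep g).2)
    obtain ⟨M, _, _, hMfin, heM, hMβ⟩ := hM₂
    obtain ⟨N, _, _, hNfin, heN, hNa, hNb⟩ := exists_coinduced (k := k) (p := p) b he.1
      (fun x => (Semigroup.mem_center_iff.mp he.2.1 x).symm) M heM
    refine hMβ ((hβb M hMfin).mpr (hNb ((hβb N hNfin).mp ((hblock N hNfin heN).mp ?_))))
    exact (hαa N hNfin).mpr (hNa a D hDb hDa)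
  · push Not at hsep
    obtain ⟨g, hg⟩ := hsep
    obtain ⟨c, d, hcd, h, hh, hah, hbh⟩ := MonoidAlgebra.exists_smul_of_not_separated
      (fun hsep => by
        obtain ⟨⟨F, hF, hF'⟩, F', hF₂, hF₂'⟩ := hsep
        exact hg ⟨F, hF, hF'⟩ F' hF₂ hF₂'.1 hF₂'.2)
    intro N _ _ hN
    rw [hαa N hN, hβb N hN]
    exact MonoidAlgebra.kerLeRangePow_iff_of_smul_add_conj_mem_augProd hA hAp hE hEp hcd hh hah
      hbh haG hbG N
end
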